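/- Theorem 1 (growth rate of the weight distribution of irregular D-GLDPC ensembles). For an irregular D-GLDPC code ensemble sequence as specified, the limit defining the growth rate G(alpha) exists for all sufficiently small admissible alpha > 0 and satisfies G(alpha) = (T/psi) alpha log alpha + alpha [ log(1/Q_1^{-1}(1)) + (T/psi) log(1/Q_2(Q_1^{-1}(1))) ] + O(alpha^xi), where xi = min{rbar/r, chi/psi + 1, 2}. -/

import Mathlib

open Filter Polynomial Finset
open scoped Classical

/-- An irregular doubly-generalized LDPC (D-GLDPC) code ensemble, specified by:
check-node (CN) types `Fin nc` with lengths `s`, dimensions `hdim`, minimum distances `rd`,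
weight enumerator coefficients `A`; variable-node (VN) types `Fin nv` with dimensions `kdim`,
lengths `q`, minimum distances `pd`, input-output weight enumerator coefficients `B`;
and edge fractions `ρ` (CN side) and `lam` (VN side). -/
structure DGLDPC where
  nc : ℕ
  nv : ℕ
  hnc : 0 < nc
  hnv : 0 < nv
  s : Fin nc → ℕ
  hdim : Fin nc → ℕ
  rd : Fin nc → ℕ
  A : Fin nc → ℕ → ℕ
  kdim : Fin nv → ℕ
  q : Fin nv → ℕ
  pd : Fin nv → ℕ
  B : Fin nv → ℕ → ℕ → ℕ
  ρ : Fin nc → ℝ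
  lam : Fin nv → ℝ
  h_hdim : ∀ t, 1 ≤ hdim t
  h_hs : ∀ t, hdim t < s t
  h_rd2 : ∀ t, 2 ≤ rd t
  h_rds : ∀ t, rd t ≤ s t
  hA0 : ∀ t, A t 0 = 1
  hAsupp : ∀ t u, u ≠ 0 → (u < rd t ∨ s t < u) → A t u = 0
  hAr : ∀ t, 0 < A t (rd t)
  h_k1 : ∀ t, 1 ≤ kdim t
  h_q1 : ∀ t, 1 ≤ q t
  h_pd2 : ∀ t, 2 ≤ pd t
  h_pdq : ∀ t, pd t ≤ q t
  hB00 : ∀ t, B t 0 0 = 1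
  hBsupp : ∀ t u v, ¬(u = 0 ∧ v = 0) →
    ¬(1 ≤ u ∧ u ≤ kdim t ∧ pd t ≤ v ∧ v ≤ q t) → B t u v = 0
  hBp : ∀ t, ∃ u, 0 < B t u (pd t)
  hρpos : ∀ t, 0 < ρ t
  hlampos : ∀ t, 0 < lam t
  hρsum : ∑ t, ρ t = 1
  hlamsum : ∑ t, lam t = 1

namespace DGLDPC

variable (M : DGLDPC)

/-- `∫ρ = ∑_t ρ_t / s_t`. -/
noncomputable def intrho : ℝ := ∑ t, M.ρ t / (M.s t : ℝ)

/-- `∫λ = ∑_t λ_t / q_t`. -/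
noncomputable def intlam : ℝ := ∑ t, M.lam t / (M.q t : ℝ)

/-- Fraction `δ_t = λ_t / (q_t ∫λ)` of VNs of type `t`. -/
noncomputable def δfrac (t : Fin M.nv) : ℝ := M.lam t / ((M.q t : ℝ) * M.intlam)

/-- `r`: the smallest CN minimum distance. -/
noncomputable def r : ℕ := sInf (Set.range M.rd)

/-- `p`: the smallest VN minimum distance. -/
noncomputable def p : ℕ := sInf (Set.range M.pd)

/-- `ψ = r/(r-1)`. -/
noncomputable def ψ : ℝ := (M.r : ℝ) / ((M.r : ℝ) - 1)

/-- `C = r ∑_{t ∈ X_c} ρ_t A_r^{(t)} / s_t`, sum over CN types of minimum distance `r`. -/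
noncomputable def Cparam : ℝ :=
  (M.r : ℝ) * ∑ t ∈ Finset.univ.filter (fun t => M.rd t = M.r),
    M.ρ t * (M.A t M.r : ℝ) / (M.s t : ℝ)

/-- `T_{i,j} = (j - ψ)/i`. -/
noncomputable def Tij (i j : ℕ) : ℝ := ((j : ℝ) - M.ψ) / (i : ℝ)

/-- `S⁻`: pairs `(i,j) ≠ (0,0)` with `B_{i,j}^{(t)} > 0` for some VN type `t`. -/
def Sminus : Set (ℕ × ℕ) := {ij | (∃ t, 0 < M.B t ij.1 ij.2) ∧ ij ≠ (0, 0)}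

/-- `T = min_{(i,j) ∈ S⁻} T_{i,j}`. -/
noncomputable def T : ℝ := sInf {x : ℝ | ∃ ij ∈ M.Sminus, x = M.Tij ij.1 ij.2}

/-- The set of candidate exponents whose infimum is
`ξ = min { r̄/r, χ/ψ + 1, 2 }` (terms coming from empty families being dropped):
it contains `2`, the values `i/r` for `i > r` with `A_i^{(t)} > 0` for some `t`
(whose minimum is `r̄/r`), and the values `(T_{i,j} - T) i / ψ + 1` for `(i,j) ∈ S⁻`
with `T_{i,j} > T` (whose minimum is `χ/ψ + 1`). -/
noncomputable def xiSet : Set ℝ :=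
  {2} ∪ {x : ℝ | ∃ i : ℕ, M.r < i ∧ (∃ t, 0 < M.A t i) ∧ x = (i : ℝ) / (M.r : ℝ)}
    ∪ {x : ℝ | ∃ ij ∈ M.Sminus, M.T < M.Tij ij.1 ij.2 ∧
        x = (M.Tij ij.1 ij.2 - M.T) * (ij.1 : ℝ) / M.ψ + 1}

/-- The exponent `ξ = min { r̄/r, χ/ψ + 1, 2 }`. -/
noncomputable def ξexp : ℝ := sInf M.xiSet

/-- The polynomial `Q₁(x)`; the sum effectively ranges over `t ∈ Y_v` and `(i,j) ∈ P_t`,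
i.e. over all `(t,i,j)` with `(i,j) ∈ S_t⁻` and `T_{i,j} = T`. -/
noncomputable def Q1 (x : ℝ) : ℝ :=
  ∑ t, (M.lam t / (M.q t : ℝ)) *
    ∑ i ∈ Finset.range (M.kdim t + 1), ∑ j ∈ Finset.range (M.q t + 1),
      if 0 < M.B t i j ∧ (i, j) ≠ (0, 0) ∧ M.Tij i j = M.T then
        (j : ℝ) * (M.B t i j : ℝ) * M.Cparam ^ ((j : ℝ) / (M.r : ℝ)) *
          (M.intlam / Real.exp 1) ^ ((i : ℝ) * M.T / M.ψ) * x ^ i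
      else 0

/-- The polynomial `Q₂(x)`. -/
noncomputable def Q2 (x : ℝ) : ℝ :=
  ∑ t, (M.lam t / (M.q t : ℝ)) *
    ∑ i ∈ Finset.range (M.kdim t + 1), ∑ j ∈ Finset.range (M.q t + 1),
      if 0 < M.B t i j ∧ (i, j) ≠ (0, 0) ∧ M.Tij i j = M.T then
        (i : ℝ) * (M.B t i j : ℝ) * M.Cparam ^ ((j : ℝ) / (M.r : ℝ)) *
          (M.intlam / Real.exp 1) ^ ((i : ℝ) * M.T / M.ψ) * x ^ i
      else 0

/-- Number of Tanner graph edges, `E = n/∫λ` (exact on admissible `n`). -/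
noncomputable def En (n : ℕ) : ℕ := ⌊(n : ℝ) / M.intlam⌋₊

/-- Number of CNs of type `t`, `γ_t m = E ρ_t / s_t` (exact on admissible `n`). -/
noncomputable def cExp (n : ℕ) (t : Fin M.nc) : ℕ := ⌊(M.En n : ℝ) * M.ρ t / (M.s t : ℝ)⌋₊

/-- Number of VNs of type `t`, `δ_t n = E λ_t / q_t` (exact on admissible `n`). -/
noncomputable def vExp (n : ℕ) (t : Fin M.nv) : ℕ := ⌊(M.En n : ℝ) * M.lam t / (M.q t : ℝ)⌋₊

/-- The CN weight enumerating polynomial `A^{(t)}(x)`. -/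
noncomputable def Apoly (t : Fin M.nc) : Polynomial ℝ :=
  ∑ u ∈ Finset.range (M.s t + 1), Polynomial.C ((M.A t u : ℕ) : ℝ) * Polynomial.X ^ u

/-- The VN bivariate weight enumerating polynomial `B^{(t)}(x,y)`, with the outer
variable recording input weight and the inner variable recording output weight. -/
noncomputable def Bpoly (t : Fin M.nv) : Polynomial (Polynomial ℝ) :=
  ∑ u ∈ Finset.range (M.kdim t + 1),
    Polynomial.C (∑ v ∈ Finset.range (M.q t + 1),
      Polynomial.C ((M.B t u v : ℕ) : ℝ) * Polynomial.X ^ v) * Polynomial.X ^ u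

/-- `N_c(v)`: the number of check-valid assignments of weight `v`, i.e. the coefficient
of `x^v` in `∏_t (A^{(t)}(x))^{γ_t m}`. -/
noncomputable def NcCount (n v : ℕ) : ℝ := (∏ t, M.Apoly t ^ M.cExp n t).coeff v

/-- `N_v(u,v)`: the coefficient of `x^u y^v` in `∏_t (B^{(t)}(x,y))^{δ_t n}`. -/
noncomputable def NvCount (n u v : ℕ) : ℝ := ((∏ t, M.Bpoly t ^ M.vExp n t).coeff u).coeff v

/-- The expected number of codewords of weight `w`:
`E[N_w] = ∑_v N_v(w,v) N_c(v) / binom(E,v)`. -/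
noncomputable def ENw (n w : ℕ) : ℝ :=
  ∑ v ∈ Finset.range (M.En n + 1),
    M.NvCount n w v * M.NcCount n v / ((M.En n).choose v : ℝ)

/-- `n` is admissible for `α` when all the relevant quantities (`E`, the numbers of
CNs and VNs of each type, and the codeword weight `α n`) are integers and the
expected number of weight-`α n` codewords is positive. -/
def Adm (α : ℝ) (n : ℕ) : Prop :=
  0 < n ∧ ((M.En n : ℝ) = (n : ℝ) / M.intlam) ∧
  (∀ t, (M.cExp n t : ℝ) = (M.En n : ℝ) * M.ρ t / (M.s t : ℝ)) ∧
  (∀ t, (M.vExp n t : ℝ) = (M.En n : ℝ) * M.lam t / (M.q t : ℝ)) ∧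
  ((⌊α * (n : ℝ)⌋₊ : ℝ) = α * (n : ℝ)) ∧
  0 < M.ENw n ⌊α * (n : ℝ)⌋₊

/-- The sequence `(1/n) log E[N_{αn}]` whose limit (along admissible `n`) is `G(α)`. -/
noncomputable def grSeq (α : ℝ) (n : ℕ) : ℝ :=
  (1 / (n : ℝ)) * Real.log (M.ENw n ⌊α * (n : ℝ)⌋₊)

end DGLDPC


lemma aux_log_fact_lower (n : ℕ) : (n:ℝ) * Real.log n - n ≤ Real.log (n.factorial : ℝ) := by
  rcases Nat.eq_zero_or_pos n with h | h
  · subst h; simp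
  have hn : (0:ℝ) < n := by exact_mod_cast h
  have h1 := Real.pow_div_factorial_le_exp (n:ℝ) hn.le n
  have hf : (0:ℝ) < (n.factorial : ℝ) := by exact_mod_cast n.factorial_pos
  have h2 : Real.log ((n:ℝ)^n / (n.factorial:ℝ)) ≤ n := by
    rw [Real.log_le_iff_le_exp (by positivity)]; exact h1
  rw [Real.log_div (by positivity) (by positivity), Real.log_pow] at h2
  linarith

lemma aux_log_fact_upper' (n : ℕ) : 
    Real.log ((n+1).factorial : ℝ) ≤ ((n+1:ℕ):ℝ) * Real.log ((n+1:ℕ):ℝ) - ((n+1:ℕ):ℝ) + 1 + Real.log ((n+1:ℕ):ℝ) := by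
  induction n with
  | zero => simp
  | succ n ih =>
    rw [Nat.factorial_succ (n+1)]
    push_cast at *
    have hn : (0:ℝ) ≤ n := Nat.cast_nonneg n
    rw [Real.log_mul (by positivity) (by positivity)]
    have h1 : 1 - (((n:ℝ)+1+1)/((n:ℝ)+1))⁻¹ ≤ Real.log (((n:ℝ)+1+1)/((n:ℝ)+1)) :=
      Real.one_sub_inv_le_log_of_pos (by positivity)
    rw [Real.log_div (by positivity) (by positivity), inv_div] at h1
    have h2 : ((n:ℝ)+1+1) * (1 - ((n:ℝ)+1)/((n:ℝ)+1+1)) = 1 := by field_simp; ring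
    have h3 := mul_le_mul_of_nonneg_left h1 (by positivity : (0:ℝ) ≤ (n:ℝ)+1+1)
    rw [h2] at h3
    nlinarith

lemma aux_log_fact_upper (n : ℕ) :
    Real.log (n.factorial : ℝ) ≤ (n:ℝ) * Real.log n - n + 1 + Real.log ((n:ℝ)+1) := by
  cases n with
  | zero => simp
  | succ n =>
    refine (aux_log_fact_upper' n).trans ?_
    have : Real.log ((n+1:ℕ):ℝ) ≤ Real.log (((n+1:ℕ):ℝ)+1) :=
      Real.log_le_log (by positivity) (by linarith)
    linarith

lemma aux_log_choose_lower (E v : ℕ) (h : v ≤ E) :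
    (E:ℝ) * Real.log E - v * Real.log v - ((E:ℝ) - v) * Real.log ((E:ℝ) - v)
      - (2 + 2 * Real.log ((E:ℝ)+1)) ≤ Real.log ((E.choose v : ℕ) : ℝ) := by
  rw [Nat.cast_choose ℝ h]
  have p1 : (0:ℝ) < (E.factorial : ℝ) := by exact_mod_cast E.factorial_pos
  have p2 : (0:ℝ) < (v.factorial : ℝ) := by exact_mod_cast v.factorial_pos
  have p3 : (0:ℝ) < ((E-v).factorial : ℝ) := by exact_mod_cast (E-v).factorial_pos
  rw [Real.log_div p1.ne' (by positivity), Real.log_mul p2.ne' p3.ne']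
  have h1 := aux_log_fact_lower E
  have h2 := aux_log_fact_upper v
  have h3 := aux_log_fact_upper (E-v)
  have hc : ((E-v:ℕ):ℝ) = (E:ℝ) - v := by push_cast [h]; ring
  rw [hc] at h3
  have hv : (v:ℝ) ≤ E := by exact_mod_cast h
  have h4 : Real.log ((v:ℝ)+1) ≤ Real.log ((E:ℝ)+1) :=
    Real.log_le_log (by positivity) (by linarith)
  have hv0 : (0:ℝ) ≤ v := by positivity
  have h5 : Real.log ((E:ℝ)-v+1) ≤ Real.log ((E:ℝ)+1) :=
    Real.log_le_log (by linarith) (by linarith)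
  linarith

lemma aux_log_choose_upper (E v : ℕ) (h : v ≤ E) (p : ℝ) (hp : 0 < p) (hp1 : p < 1) :
    Real.log ((E.choose v : ℕ) : ℝ) ≤ - (v * Real.log p) - ((E:ℝ)-v) * Real.log (1-p) := by
  have hs : p ^ v * (1-p)^(E-v) * (E.choose v : ℝ) ≤ (p + (1-p))^E := by
    rw [add_pow]
    have := Finset.single_le_sum (f := fun m => p ^ m * (1-p)^(E-m) * (E.choose m : ℝ)) (s := range (E+1))
      (fun i _ => by have : 0 < 1 - p := by linarith
                     positivity) (Finset.mem_range.2 (Nat.lt_succ_of_le h))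
    exact this
  rw [add_sub_cancel, one_pow] at hs
  have h0 : 0 < 1 - p := by linarith
  have hc : (0:ℝ) < (E.choose v : ℝ) := by exact_mod_cast Nat.choose_pos h
  have := Real.log_le_log (by positivity) hs
  rw [Real.log_mul (by positivity) hc.ne', Real.log_mul (by positivity) (by positivity), Real.log_pow, Real.log_pow,
    Real.log_one] at this
  have hcc : ((E-v:ℕ):ℝ) = (E:ℝ) - v := by push_cast [h]; ring
  rw [hcc] at this
  linarith

/-- univariate cone -/
noncomputable def auxConeU : Subsemiring ℝ[X] where
  carrier := {p | ∀ n, 0 ≤ p.coeff n}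
  mul_mem' := by
    intro a b ha hb n
    rw [coeff_mul]
    exact Finset.sum_nonneg fun x _ => mul_nonneg (ha _) (hb _)
  one_mem' := by
    intro n; rw [coeff_one]; split_ifs <;> norm_num
  add_mem' := by
    intro a b ha hb n; rw [coeff_add]; exact add_nonneg (ha n) (hb n)
  zero_mem' := by intro n; simp

noncomputable def auxConeB : Subsemiring ℝ[X][X] where
  carrier := {p | ∀ n, p.coeff n ∈ auxConeU}
  mul_mem' := by
    intro a b ha hb n
    rw [coeff_mul]
    exact sum_mem fun x _ => mul_mem (ha _) (hb _)
  one_mem' := by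
    intro n; rw [coeff_one]; split_ifs
    · exact one_mem _
    · exact zero_mem _
  add_mem' := by
    intro a b ha hb n; rw [coeff_add]; exact add_mem (ha n) (hb n)
  zero_mem' := by intro n; rw [coeff_zero]; exact zero_mem _

/-- support cone -/
noncomputable def auxSupp (D : ℕ) : Subsemiring ℝ[X][X] where
  carrier := {p | ∀ u v, (p.coeff u).coeff v ≠ 0 → v ≤ D * u ∧ u ≤ D * v}
  mul_mem' := by
    intro a b ha hb u v h
    rw [coeff_mul, finsetSum_coeff] at h
    obtain ⟨x, hx, hx'⟩ := Finset.exists_ne_zero_of_sum_ne_zero h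
    rw [coeff_mul] at hx'
    obtain ⟨y, hy, hy'⟩ := Finset.exists_ne_zero_of_sum_ne_zero hx'
    have h1 := ha _ _ (left_ne_zero_of_mul hy')
    have h2 := hb _ _ (right_ne_zero_of_mul hy')
    rw [HasAntidiagonal.mem_antidiagonal] at hx hy
    rw [← hx, ← hy]
    constructor <;> rw [mul_add] <;> omega
  one_mem' := by
    intro u v h
    rw [coeff_one] at h
    split_ifs at h with h1
    · rw [coeff_one] at h
      split_ifs at h with h2
      · subst h1; subst h2; simp
      · simp at h
    · simp at h
  add_mem' := by
    intro a b ha hb u v h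
    rw [coeff_add, coeff_add] at h
    by_cases h1 : (a.coeff u).coeff v = 0
    · exact hb u v (by rw [h1, zero_add] at h; exact h)
    · exact ha u v h1
  zero_mem' := by intro u v h; simp at h

lemma aux_mul_ge {R : Type*} [CommRing R] (S : Subsemiring R) {a a' b b' : R} (h1 : a - a' ∈ S) (h2 : b - b' ∈ S)
    (ha : a' ∈ S) (hb : b' ∈ S) : a * b - a' * b' ∈ S := by
  have : a * b - a' * b' = (a - a') * (b - b') + (a-a') * b' + a' * (b - b') := by ring
  rw [this]
  exact add_mem (add_mem (mul_mem h1 h2) (mul_mem h1 hb)) (mul_mem ha h2)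

lemma aux_prod_ge {R ι : Type*} [CommRing R] (S : Subsemiring R) (s : Finset ι) (f g : ι → R)
    (h1 : ∀ i ∈ s, f i - g i ∈ S) (h2 : ∀ i ∈ s, g i ∈ S) : ∏ i ∈ s, f i - ∏ i ∈ s, g i ∈ S := by
  induction s using Finset.induction_on with
  | empty => simp
  | insert a s ha ih =>
    rw [Finset.prod_insert ha, Finset.prod_insert ha]
    refine aux_mul_ge S (h1 a (by simp)) (ih (fun i hi => h1 i (by simp [hi])) (fun i hi => h2 i (by simp [hi])))
      (h2 a (by simp)) (prod_mem fun i hi => h2 i (by simp [hi]))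

lemma aux_sum_pow_ge {R ι : Type*} [CommRing R] (S : Subsemiring R) (s : Finset ι) (g : ι → R)
    (hg : ∀ i ∈ s, g i ∈ S) (k : ι → ℕ) (hk : ∀ i ∉ s, k i = 0) (N : ℕ) (hN : ∑ i ∈ s, k i = N) :
    (∑ i ∈ s, g i) ^ N - (Nat.multinomial s k : R) * ∏ i ∈ s, g i ^ k i ∈ S := by
  rw [Finset.sum_pow_eq_sum_piAntidiag]
  have hmem : k ∈ piAntidiag s N := by
    rw [mem_piAntidiag]
    refine ⟨hN, fun i hi => ?_⟩
    by_contra h; exact hi (hk i h)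
  rw [← Finset.add_sum_erase _ _ hmem, add_sub_cancel_left]
  refine sum_mem fun j _ => mul_mem (natCast_mem _ _) (prod_mem fun i hi => pow_mem (hg i hi) _)

lemma aux_chernU (p : ℝ[X]) (hp : p ∈ auxConeU) (z : ℝ) (hz : 0 ≤ z) (v : ℕ) :
    p.coeff v * z ^ v ≤ p.eval z := by
  have hp' : ∀ n, 0 ≤ p.coeff n := hp
  rw [Polynomial.eval_eq_sum_range' (n := max (p.natDegree+1) (v+1)) (by omega)]
  exact Finset.single_le_sum (f := fun i => p.coeff i * z ^ i)
    (fun i _ => mul_nonneg (hp' i) (pow_nonneg hz _)) (Finset.mem_range.2 (by omega))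

lemma aux_chernB (p : ℝ[X][X]) (hp : p ∈ auxConeB) (x y : ℝ) (hx : 0 ≤ x) (hy : 0 ≤ y) (u v : ℕ) :
    (p.coeff u).coeff v * x ^ u * y ^ v ≤ (p.eval (C x)).eval y := by
  have hp' : ∀ n m, 0 ≤ (p.coeff n).coeff m := hp
  have h1 : (p.eval (C x)) ∈ auxConeU := by
    intro m
    rw [Polynomial.eval_eq_sum_range, finsetSum_coeff]
    refine Finset.sum_nonneg fun i _ => ?_
    rw [← C_pow, coeff_mul_C]
    exact mul_nonneg (hp' _ _) (pow_nonneg hx _)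
  refine le_trans ?_ (aux_chernU _ h1 y hy v)
  refine mul_le_mul_of_nonneg_right ?_ (pow_nonneg hy _)
  rw [Polynomial.eval_eq_sum_range' (n := max (p.natDegree+1) (u+1)) (by omega), finsetSum_coeff]
  have := Finset.single_le_sum (f := fun i => (p.coeff i * C x ^ i).coeff v) (s := range (max (p.natDegree+1) (u+1)))
    (fun i _ => by
      show 0 ≤ (p.coeff i * C x ^ i).coeff v
      rw [← C_pow, coeff_mul_C]
      exact mul_nonneg (hp' _ _) (pow_nonneg hx _)) (Finset.mem_range.2 (by omega : u < _))
  refine le_trans (le_of_eq ?_) this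
  simp only [← C_pow, coeff_mul_C]

lemma aux_coeff_mul_geU (p q : ℝ[X]) (hp : p ∈ auxConeU) (hq : q ∈ auxConeU) (a b : ℕ) :
    p.coeff a * q.coeff b ≤ (p * q).coeff (a + b) := by
  have hp' : ∀ n, 0 ≤ p.coeff n := hp
  have hq' : ∀ n, 0 ≤ q.coeff n := hq
  rw [coeff_mul]
  exact Finset.single_le_sum (f := fun x : ℕ × ℕ => p.coeff x.1 * q.coeff x.2)
    (fun i _ => mul_nonneg (hp' _) (hq' _)) (a := (a,b)) (by simp)

lemma aux_coeff_mul_geB (p q : ℝ[X][X]) (hp : p ∈ auxConeB) (hq : q ∈ auxConeB) (a b c d : ℕ) :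
    (p.coeff a).coeff c * (q.coeff b).coeff d ≤ ((p * q).coeff (a + b)).coeff (c + d) := by
  have hp' : ∀ n, p.coeff n ∈ auxConeU := hp
  have hq' : ∀ n, q.coeff n ∈ auxConeU := hq
  refine (aux_coeff_mul_geU _ _ (hp' a) (hq' b) c d).trans ?_
  rw [coeff_mul p q, finsetSum_coeff]
  exact Finset.single_le_sum (f := fun x : ℕ × ℕ => (p.coeff x.1 * q.coeff x.2).coeff (c+d))
    (fun i _ => mul_mem (hp' i.1) (hq' i.2) (c+d)) (a := (a,b)) (by simp)


namespace DGLDPC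
variable (M : DGLDPC)

lemma aux_r_le (t : Fin M.nc) : M.r ≤ M.rd t := Nat.sInf_le ⟨t, rfl⟩

lemma aux_r_att : ∃ t, M.rd t = M.r := by
  have : (Set.range M.rd).Nonempty := ⟨M.rd ⟨0, M.hnc⟩, _, rfl⟩
  exact Nat.sInf_mem this

lemma aux_r2 : 2 ≤ M.r := by
  obtain ⟨t, ht⟩ := M.aux_r_att
  rw [← ht]; exact M.h_rd2 t

lemma aux_r2R : (2:ℝ) ≤ M.r := by exact_mod_cast M.aux_r2

lemma aux_psi_pos : 0 < M.ψ := by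
  have := M.aux_r2R
  unfold ψ
  apply div_pos <;> linarith

lemma aux_psi_le : M.ψ ≤ 2 := by
  have := M.aux_r2R
  unfold ψ
  rw [div_le_iff₀ (by linarith)]; linarith

lemma aux_psi_inv : 1 / M.ψ = 1 - 1 / (M.r:ℝ) := by
  have := M.aux_r2R
  have h0 : (M.r:ℝ) ≠ 0 := by linarith
  have h1 : (M.r:ℝ) - 1 ≠ 0 := by intro h; linarith
  unfold ψ
  field_simp

lemma aux_s_pos (t) : (0:ℝ) < M.s t := by
  have := M.h_hs t
  exact_mod_cast (by omega : 0 < M.s t)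

lemma aux_q_pos (t) : (0:ℝ) < M.q t := by
  have := M.h_q1 t
  exact_mod_cast (by omega : 0 < M.q t)

lemma aux_lq_pos (t) : 0 < M.lam t / (M.q t:ℝ) := div_pos (M.hlampos t) (M.aux_q_pos t)
lemma aux_rs_pos (t) : 0 < M.ρ t / (M.s t:ℝ) := div_pos (M.hρpos t) (M.aux_s_pos t)

lemma aux_intlam_pos : 0 < M.intlam := by
  unfold intlam
  exact Finset.sum_pos (fun t _ => M.aux_lq_pos t) ⟨⟨0, M.hnv⟩, by simp⟩

lemma aux_A_r_zero (t) (h : M.rd t ≠ M.r) : M.A t M.r = 0 := by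
  have h1 := M.aux_r_le t
  have h2 := M.aux_r2
  exact M.hAsupp t _ (by omega) (Or.inl (by omega))

lemma aux_C_eq : M.Cparam = (M.r:ℝ) * ∑ t, M.ρ t / (M.s t:ℝ) * (M.A t M.r : ℝ) := by
  unfold Cparam
  congr 1
  rw [Finset.sum_filter]
  refine Finset.sum_congr rfl fun t _ => ?_
  split_ifs with h
  · ring
  · rw [M.aux_A_r_zero t h]; simp

lemma aux_C_pos : 0 < M.Cparam := by
  rw [aux_C_eq]
  have h2 := M.aux_r2R
  refine mul_pos (by linarith) ?_
  obtain ⟨t, ht⟩ := M.aux_r_att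
  refine Finset.sum_pos' (fun t _ => mul_nonneg (M.aux_rs_pos t).le (Nat.cast_nonneg _)) ⟨t, by simp, ?_⟩
  refine mul_pos (M.aux_rs_pos t) ?_
  rw [← ht]; exact_mod_cast M.hAr t

lemma aux_B_supp (t : Fin M.nv) (i j : ℕ) (h : 0 < M.B t i j) (h0 : (i,j) ≠ (0,0)) :
    1 ≤ i ∧ i ≤ M.kdim t ∧ 2 ≤ j ∧ j ≤ M.q t := by
  by_contra hc
  have := M.hBsupp t i j (by simpa using h0) (by
    intro h'; apply hc
    have := M.h_pd2 t
    exact ⟨h'.1, h'.2.1, by omega, h'.2.2.2⟩)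
  omega

/-- all nontrivial support triples -/
noncomputable def auxS : Finset (Fin M.nv × ℕ × ℕ) :=
  ((Finset.univ : Finset (Fin M.nv)) ×ˢ (range (∑ t, M.kdim t + 1) ×ˢ range (∑ t, M.q t + 1))).filter
    (fun p => 0 < M.B p.1 p.2.1 p.2.2 ∧ p.2 ≠ (0,0))

lemma aux_k_le (t) : M.kdim t ≤ ∑ t, M.kdim t := Finset.single_le_sum (f := M.kdim) (by simp) (by simp)
lemma aux_q_le (t) : M.q t ≤ ∑ t, M.q t := Finset.single_le_sum (f := M.q) (by simp) (by simp)

lemma aux_mem_S (p : Fin M.nv × ℕ × ℕ) : p ∈ M.auxS ↔ 0 < M.B p.1 p.2.1 p.2.2 ∧ p.2 ≠ (0,0) := by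
  unfold auxS
  rw [Finset.mem_filter]
  constructor
  · exact fun h => h.2
  · intro h
    refine ⟨?_, h⟩
    obtain ⟨t, i, j⟩ := p
    have h1 := M.aux_B_supp t i j h.1 h.2
    have h2 := M.aux_k_le t
    have h3 := M.aux_q_le t
    simp only [Finset.mem_product, Finset.mem_univ, Finset.mem_range, true_and]
    omega

lemma aux_S_bd {p : Fin M.nv × ℕ × ℕ} (h : p ∈ M.auxS) :
    1 ≤ p.2.1 ∧ p.2.1 ≤ M.kdim p.1 ∧ 2 ≤ p.2.2 ∧ p.2.2 ≤ M.q p.1 :=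
  M.aux_B_supp _ _ _ ((M.aux_mem_S p).1 h).1 ((M.aux_mem_S p).1 h).2

noncomputable def auxP : Finset (Fin M.nv × ℕ × ℕ) := M.auxS.filter (fun p => M.Tij p.2.1 p.2.2 = M.T)

lemma aux_P_S {p : Fin M.nv × ℕ × ℕ} (h : p ∈ M.auxP) : p ∈ M.auxS := (Finset.mem_filter.1 h).1

lemma aux_sum_triple (g : Fin M.nv → ℕ → ℕ → ℝ)
    (hg : ∀ t i j, (t, i, j) ∉ M.auxS → g t i j = 0) (t : Fin M.nv) :
    ∑ i ∈ range (M.kdim t + 1), ∑ j ∈ range (M.q t + 1), g t i j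
     = ∑ p ∈ M.auxS.filter (fun p => p.1 = t), g p.1 p.2.1 p.2.2 := by
  rw [← Finset.sum_product']
  symm
  refine Finset.sum_bij_ne_zero (fun p _ _ => p.2) ?_ ?_ ?_ ?_
  · intro p hp _
    rw [Finset.mem_filter] at hp
    have := M.aux_S_bd hp.1
    rw [hp.2] at this
    simp only [Finset.mem_product, Finset.mem_range]; omega
  · intro p hp _ p' hp' _ h
    rw [Finset.mem_filter] at hp hp'
    exact Prod.ext (hp.2.trans hp'.2.symm) h
  · intro b hb hne
    have hS : (t, b.1, b.2) ∈ M.auxS := by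
      by_contra h; exact hne (hg _ _ _ h)
    exact ⟨(t, b.1, b.2), Finset.mem_filter.2 ⟨hS, rfl⟩, hne, rfl⟩
  · intro p hp _
    rw [Finset.mem_filter] at hp
    rw [hp.2]

lemma aux_sum_triple' (a : Fin M.nv → ℝ) (g : Fin M.nv → ℕ → ℕ → ℝ)
    (hg : ∀ t i j, (t, i, j) ∉ M.auxS → g t i j = 0)  :
    ∑ t, a t * ∑ i ∈ range (M.kdim t + 1), ∑ j ∈ range (M.q t + 1), g t i j
     = ∑ p ∈ M.auxS, a p.1 * g p.1 p.2.1 p.2.2 := by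
  rw [← Finset.sum_fiberwise M.auxS (fun p => p.1)]
  refine Finset.sum_congr rfl fun t _ => ?_
  rw [M.aux_sum_triple g hg, Finset.mul_sum]
  refine Finset.sum_congr rfl fun p hp => ?_
  rw [(Finset.mem_filter.1 hp).2]

/-- coefficient weights -/
noncomputable def auxc (y : ℝ) (p : Fin M.nv × ℕ × ℕ) : ℝ :=
  M.lam p.1 / (M.q p.1 : ℝ) * (M.B p.1 p.2.1 p.2.2 : ℝ) * M.Cparam ^ ((p.2.2 : ℝ) / (M.r : ℝ)) *
          (M.intlam / Real.exp 1) ^ ((p.2.1 : ℝ) * M.T / M.ψ) * y ^ p.2.1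

lemma aux_Q1 (y : ℝ) : M.Q1 y = ∑ p ∈ M.auxP, (p.2.2 : ℝ) * M.auxc y p := by
  unfold Q1
  rw [M.aux_sum_triple' (fun t => M.lam t / (M.q t:ℝ)) (fun t i j => 
    if 0 < M.B t i j ∧ (i, j) ≠ (0, 0) ∧ M.Tij i j = M.T then
        (j : ℝ) * (M.B t i j : ℝ) * M.Cparam ^ ((j : ℝ) / (M.r : ℝ)) *
          (M.intlam / Real.exp 1) ^ ((i : ℝ) * M.T / M.ψ) * y ^ i
      else 0)]
  · unfold auxP
    rw [Finset.sum_filter]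
    refine Finset.sum_congr rfl fun p hp => ?_
    have h := (M.aux_mem_S p).1 hp
    by_cases hT : M.Tij p.2.1 p.2.2 = M.T
    · rw [if_pos ⟨h.1, h.2, hT⟩, if_pos hT]; unfold auxc; ring
    · rw [if_neg (fun h => hT h.2.2), if_neg hT, mul_zero]
  · intro t i j h
    rw [if_neg]
    intro h'; exact h ((M.aux_mem_S _).2 ⟨h'.1, h'.2.1⟩)

lemma aux_Q2 (y : ℝ) : M.Q2 y = ∑ p ∈ M.auxP, (p.2.1 : ℝ) * M.auxc y p := by
  unfold Q2
  rw [M.aux_sum_triple' (fun t => M.lam t / (M.q t:ℝ)) (fun t i j => 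
    if 0 < M.B t i j ∧ (i, j) ≠ (0, 0) ∧ M.Tij i j = M.T then
        (i : ℝ) * (M.B t i j : ℝ) * M.Cparam ^ ((j : ℝ) / (M.r : ℝ)) *
          (M.intlam / Real.exp 1) ^ ((i : ℝ) * M.T / M.ψ) * y ^ i
      else 0)]
  · unfold auxP
    rw [Finset.sum_filter]
    refine Finset.sum_congr rfl fun p hp => ?_
    have h := (M.aux_mem_S p).1 hp
    by_cases hT : M.Tij p.2.1 p.2.2 = M.T
    · rw [if_pos ⟨h.1, h.2, hT⟩, if_pos hT]; unfold auxc; ring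
    · rw [if_neg (fun h => hT h.2.2), if_neg hT, mul_zero]
  · intro t i j h
    rw [if_neg]
    intro h'; exact h ((M.aux_mem_S _).2 ⟨h'.1, h'.2.1⟩)

lemma aux_S_nonempty : M.auxS.Nonempty := by
  obtain ⟨u, hu⟩ := M.hBp ⟨0, M.hnv⟩
  refine ⟨(⟨0, M.hnv⟩, u, M.pd ⟨0, M.hnv⟩), (M.aux_mem_S _).2 ⟨hu, ?_⟩⟩
  have := M.h_pd2 ⟨0, M.hnv⟩
  intro h
  have h2 := congrArg Prod.snd h
  simp only at h2
  omega

lemma aux_Tset : {x : ℝ | ∃ ij ∈ M.Sminus, x = M.Tij ij.1 ij.2} = ((M.auxS.image (fun p => M.Tij p.2.1 p.2.2) : Finset ℝ) : Set ℝ) := by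
  ext x
  simp only [Set.mem_ofPred_eq, Finset.coe_image, Set.mem_image, Finset.mem_coe, Sminus]
  constructor
  · rintro ⟨ij, ⟨⟨t, ht⟩, h0⟩, rfl⟩
    exact ⟨(t, ij), (M.aux_mem_S _).2 ⟨ht, h0⟩, rfl⟩
  · rintro ⟨p, hp, rfl⟩
    have := (M.aux_mem_S _).1 hp
    exact ⟨p.2, ⟨⟨p.1, this.1⟩, this.2⟩, rfl⟩

lemma aux_T_le {p : Fin M.nv × ℕ × ℕ} (h : p ∈ M.auxS) : M.T ≤ M.Tij p.2.1 p.2.2 := by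
  unfold T
  rw [aux_Tset]
  exact csInf_le (Finset.bddBelow _) (by
    rw [Finset.mem_coe]; exact Finset.mem_image_of_mem _ h)

lemma aux_P_nonempty : M.auxP.Nonempty := by
  have hne : (M.auxS.image (fun p => M.Tij p.2.1 p.2.2)).Nonempty := M.aux_S_nonempty.image _
  have := Finset.Nonempty.csInf_mem hne
  rw [← aux_Tset] at this
  obtain ⟨p, hp, h⟩ := Finset.mem_image.1 this
  exact ⟨p, Finset.mem_filter.2 ⟨hp, h⟩⟩

lemma aux_Tij_mul {p : Fin M.nv × ℕ × ℕ} (h : p ∈ M.auxS) :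
    (p.2.2:ℝ) = M.ψ + p.2.1 * M.Tij p.2.1 p.2.2 := by
  have h1 := (M.aux_S_bd h).1
  have h2 : (p.2.1:ℝ) ≠ 0 := by
    have : 0 < p.2.1 := h1
    positivity
  unfold Tij
  field_simp
  ring

lemma aux_P_eq {p : Fin M.nv × ℕ × ℕ} (h : p ∈ M.auxP) : (p.2.2:ℝ) = M.ψ + p.2.1 * M.T := by
  rw [M.aux_Tij_mul (M.aux_P_S h), (Finset.mem_filter.1 h).2]

lemma aux_T_nonneg : 0 ≤ M.T := by
  obtain ⟨p, hp⟩ := M.aux_P_nonempty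
  have h1 := M.aux_P_eq hp
  have h2 := M.aux_S_bd (M.aux_P_S hp)
  have h3 : (2:ℝ) ≤ p.2.2 := by exact_mod_cast h2.2.2.1
  have h4 := M.aux_psi_le
  have h5 : (0:ℝ) < p.2.1 := by exact_mod_cast h2.1
  by_contra h
  push Not at h
  nlinarith

lemma aux_c_pos {y : ℝ} (hy : 0 < y) {p : Fin M.nv × ℕ × ℕ} (h : p ∈ M.auxS) : 0 < M.auxc y p := by
  unfold auxc
  have h1 := M.aux_lq_pos p.1
  have h2 : (0:ℝ) < M.B p.1 p.2.1 p.2.2 := by exact_mod_cast ((M.aux_mem_S p).1 h).1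
  have h3 := Real.rpow_pos_of_pos M.aux_C_pos ((p.2.2 : ℝ) / (M.r : ℝ))
  have h4 : 0 < (M.intlam / Real.exp 1) ^ ((p.2.1 : ℝ) * M.T / M.ψ) :=
    Real.rpow_pos_of_pos (div_pos M.aux_intlam_pos (Real.exp_pos 1)) _
  positivity

lemma aux_c_scale (y : ℝ) (p : Fin M.nv × ℕ × ℕ) : M.auxc y p = M.auxc 1 p * y ^ p.2.1 := by
  unfold auxc; rw [one_pow, mul_one]

lemma aux_Q1_mono : StrictMonoOn M.Q1 (Set.Ici 0) := by
  intro a ha b hb hab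
  rw [aux_Q1, aux_Q1]
  refine Finset.sum_lt_sum_of_nonempty M.aux_P_nonempty fun p hp => ?_
  have h2 := M.aux_S_bd (M.aux_P_S hp)
  have h3 : (0:ℝ) < p.2.2 := by exact_mod_cast (by omega : 0 < p.2.2)
  rw [M.aux_c_scale a, M.aux_c_scale b]
  have := M.aux_c_pos one_pos (M.aux_P_S hp)
  have h5 : a ^ p.2.1 < b ^ p.2.1 := pow_lt_pow_left₀ hab ha (by omega)
  gcongr

lemma aux_Q1_cont : Continuous M.Q1 := by
  have : M.Q1 = fun y => ∑ p ∈ M.auxP, (p.2.2 : ℝ) * (M.auxc 1 p * y ^ p.2.1) := by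
    ext y; rw [aux_Q1]
    exact Finset.sum_congr rfl fun p _ => by rw [M.aux_c_scale y]
  rw [this]
  fun_prop

lemma aux_y_exists : ∃ y, 0 < y ∧ M.Q1 y = 1 ∧ ∀ y' : ℝ, 0 ≤ y' → M.Q1 y' = 1 → y' = y := by
  have h0 : M.Q1 0 = 0 := by
    rw [aux_Q1]
    refine Finset.sum_eq_zero fun p hp => ?_
    have h2 := M.aux_S_bd (M.aux_P_S hp)
    rw [M.aux_c_scale, zero_pow (by omega)]; simp
  obtain ⟨p, hp⟩ := M.aux_P_nonempty
  have h2 := M.aux_S_bd (M.aux_P_S hp)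
  have hc := M.aux_c_pos one_pos (M.aux_P_S hp)
  set X : ℝ := max 1 (1 / M.auxc 1 p) with hX
  have hX1 : 1 ≤ X := le_max_left _ _
  have h1 : 1 ≤ M.Q1 X := by
    rw [aux_Q1]
    have hs := Finset.single_le_sum (f := fun p : Fin M.nv × ℕ × ℕ => (p.2.2:ℝ) * M.auxc X p) (s := M.auxP)
      (fun p hp => mul_nonneg (Nat.cast_nonneg _) (M.aux_c_pos (by linarith) (M.aux_P_S hp)).le) hp
    refine le_trans ?_ hs
    rw [M.aux_c_scale]
    have hj : (1:ℝ) ≤ p.2.2 := by exact_mod_cast (by omega : 1 ≤ p.2.2)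
    have hx : X ≤ X ^ p.2.1 := le_self_pow₀ hX1 (by omega)
    have hx2 : 1 ≤ M.auxc 1 p * X := by
      have : 1 / M.auxc 1 p ≤ X := le_max_right _ _
      rw [div_le_iff₀ hc] at this; linarith
    have hx3 : 1 ≤ M.auxc 1 p * X ^ p.2.1 := hx2.trans (by gcongr)
    nlinarith
  obtain ⟨y, hy, hy1⟩ := intermediate_value_Icc (by linarith : (0:ℝ) ≤ X) (M.aux_Q1_cont.continuousOn)
    (show (1:ℝ) ∈ Set.Icc (M.Q1 0) (M.Q1 X) from ⟨by rw [h0]; norm_num, h1⟩)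
  have hypos : 0 < y := by
    rcases hy.1.lt_or_eq with h | h
    · exact h
    · rw [← h, h0] at hy1; norm_num at hy1
  refine ⟨y, hypos, hy1, fun y' h' h1' => ?_⟩
  exact M.aux_Q1_mono.injOn h' hypos.le (h1'.trans hy1.symm)

lemma aux_Q2_pos {y : ℝ} (hy : 0 < y) : 0 < M.Q2 y := by
  rw [aux_Q2]
  refine Finset.sum_pos (fun p hp => ?_) M.aux_P_nonempty
  have h2 := M.aux_S_bd (M.aux_P_S hp)
  have h3 : (0:ℝ) < p.2.1 := by exact_mod_cast (by omega : 0 < p.2.1)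
  exact mul_pos h3 (M.aux_c_pos hy (M.aux_P_S hp))

lemma aux_sum_c (y : ℝ) : ∑ p ∈ M.auxP, M.auxc y p = (M.Q1 y - M.T * M.Q2 y) / M.ψ := by
  rw [aux_Q1, aux_Q2, eq_div_iff M.aux_psi_pos.ne', Finset.sum_mul, Finset.mul_sum, ← Finset.sum_sub_distrib]
  refine Finset.sum_congr rfl fun p hp => ?_
  rw [M.aux_P_eq hp]; ring

lemma aux_xi_bdd : BddBelow M.xiSet := by
  refine ⟨0, ?_⟩
  rintro x ((h | h) | h)
  · rw [Set.mem_singleton_iff.1 h]; norm_num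
  · obtain ⟨i, _, _, rfl⟩ := h
    positivity
  · obtain ⟨ij, _, h1, rfl⟩ := h
    have := M.aux_psi_pos
    have h2 : 0 < M.Tij ij.1 ij.2 - M.T := by linarith
    positivity

lemma aux_xi_le2 : M.ξexp ≤ 2 := csInf_le M.aux_xi_bdd (Or.inl (Or.inl rfl))

lemma aux_xi_leA {t : Fin M.nc} {i : ℕ} (h : M.r < i) (hA : 0 < M.A t i) : M.ξexp ≤ (i:ℝ) / M.r :=
  csInf_le M.aux_xi_bdd (Or.inl (Or.inr ⟨i, h, ⟨t, hA⟩, rfl⟩))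

lemma aux_xi_leB {p : Fin M.nv × ℕ × ℕ} (h : p ∈ M.auxS) (hp : p ∉ M.auxP) :
    M.ξexp ≤ (M.Tij p.2.1 p.2.2 - M.T) * (p.2.1 : ℝ) / M.ψ + 1 := by
  refine csInf_le M.aux_xi_bdd (Or.inr ⟨p.2, ⟨⟨p.1, ((M.aux_mem_S p).1 h).1⟩, ((M.aux_mem_S p).1 h).2⟩, ?_, rfl⟩)
  refine lt_of_le_of_ne (M.aux_T_le h) fun h' => hp (Finset.mem_filter.2 ⟨h, h'.symm⟩)

end DGLDPC


namespace DGLDPC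
variable (M : DGLDPC)

lemma aux_Apoly_mem (t) : M.Apoly t ∈ auxConeU := by
  unfold Apoly
  refine sum_mem fun u _ => ?_
  intro n
  rw [coeff_C_mul_X_pow]
  split_ifs
  · positivity
  · exact le_rfl

lemma aux_Bpoly_mem (t) : M.Bpoly t ∈ auxConeB := by
  unfold Bpoly
  refine sum_mem fun u _ => ?_
  intro n
  rw [coeff_C_mul_X_pow]
  split_ifs
  · refine sum_mem fun v _ => ?_
    intro m
    rw [coeff_C_mul_X_pow]
    split_ifs
    · positivity
    · exact le_rfl
  · exact zero_mem _

noncomputable def auxD : ℕ := ∑ t, M.kdim t + ∑ t, M.q t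

lemma aux_Bpoly_supp (t) : M.Bpoly t ∈ auxSupp M.auxD := by
  unfold Bpoly
  refine sum_mem fun i _ => ?_
  intro u v h
  rw [coeff_C_mul_X_pow] at h
  split_ifs at h with hu
  · subst hu
    rw [finsetSum_coeff] at h
    obtain ⟨j, hj, h⟩ := Finset.exists_ne_zero_of_sum_ne_zero h
    rw [coeff_C_mul_X_pow] at h
    split_ifs at h with hv
    · subst hv
      have hB : 0 < M.B t u v := by
        rcases Nat.eq_zero_or_pos (M.B t u v) with h' | h'
        · rw [h'] at h; simp at h
        · exact h'
      by_cases h0 : (u, v) = (0,0)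
      · simp only [Prod.mk.injEq] at h0; rw [h0.1, h0.2]; simp
      · have h1 := M.aux_B_supp t u v hB h0
        have h2 := M.aux_k_le t
        have h3 := M.aux_q_le t
        unfold auxD
        constructor <;> nlinarith
    · simp at h
  · simp at h

lemma aux_PA_mem (n) : ∏ t, M.Apoly t ^ M.cExp n t ∈ auxConeU :=
  prod_mem fun t _ => pow_mem (M.aux_Apoly_mem t) _
lemma aux_PB_mem (n) : ∏ t, M.Bpoly t ^ M.vExp n t ∈ auxConeB :=
  prod_mem fun t _ => pow_mem (M.aux_Bpoly_mem t) _
lemma aux_PB_supp (n) : ∏ t, M.Bpoly t ^ M.vExp n t ∈ auxSupp M.auxD :=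
  prod_mem fun t _ => pow_mem (M.aux_Bpoly_supp t) _

lemma aux_Nc_nonneg (n v) : 0 ≤ M.NcCount n v := M.aux_PA_mem n v
lemma aux_Nv_nonneg (n u v) : 0 ≤ M.NvCount n u v := M.aux_PB_mem n u v

/-- integrality -/
def auxInt (n : ℕ) : Prop := ((M.En n : ℝ) = (n : ℝ) / M.intlam) ∧
  (∀ t, (M.cExp n t : ℝ) = (M.En n : ℝ) * M.ρ t / (M.s t : ℝ)) ∧
  (∀ t, (M.vExp n t : ℝ) = (M.En n : ℝ) * M.lam t / (M.q t : ℝ))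

lemma aux_Adm_iff (α : ℝ) (n : ℕ) : M.Adm α n ↔ 0 < n ∧ M.auxInt n ∧ ((⌊α * (n : ℝ)⌋₊ : ℝ) = α * (n : ℝ)) ∧
  0 < M.ENw n ⌊α * (n : ℝ)⌋₊ := by
  unfold Adm auxInt; tauto

lemma aux_int_add {a b : ℕ} (ha : M.auxInt a) (hb : M.auxInt b) :
    M.En (a+b) = M.En a + M.En b ∧ (∀ t, M.cExp (a+b) t = M.cExp a t + M.cExp b t) ∧
    (∀ t, M.vExp (a+b) t = M.vExp a t + M.vExp b t) := by
  obtain ⟨a1, a2, a3⟩ := ha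
  obtain ⟨b1, b2, b3⟩ := hb
  have hE : M.En (a+b) = M.En a + M.En b := by
    rw [En, Nat.cast_add, add_div, ← a1, ← b1, ← Nat.cast_add, Nat.floor_natCast]
  refine ⟨hE, fun t => ?_, fun t => ?_⟩
  · rw [cExp, hE, Nat.cast_add, add_mul, add_div, ← a2, ← b2, ← Nat.cast_add, Nat.floor_natCast]
  · rw [vExp, hE, Nat.cast_add, add_mul, add_div, ← a3, ← b3, ← Nat.cast_add, Nat.floor_natCast]

lemma aux_int_add' {a b : ℕ} (ha : M.auxInt a) (hb : M.auxInt b) : M.auxInt (a+b) := by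
  obtain ⟨h1, h2, h3⟩ := M.aux_int_add ha hb
  obtain ⟨a1, a2, a3⟩ := ha
  obtain ⟨b1, b2, b3⟩ := hb
  refine ⟨?_, fun t => ?_, fun t => ?_⟩
  · rw [h1]; push_cast; rw [a1, b1]; ring
  · rw [h1, h2]; push_cast; rw [a2, b2]; ring
  · rw [h1, h3]; push_cast; rw [a3, b3]; ring

lemma aux_En_zero : M.En 0 = 0 := by simp [En]
lemma aux_int_zero : M.auxInt 0 := by
  refine ⟨by simp [En], fun t => by simp [cExp, En], fun t => by simp [vExp, En]⟩

lemma aux_int_mul {a : ℕ} (ha : M.auxInt a) (k : ℕ) : M.auxInt (k*a) ∧ M.En (k*a) = k * M.En a := by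
  induction k with
  | zero => simpa using ⟨M.aux_int_zero, M.aux_En_zero⟩
  | succ k ih =>
    have : (k+1)*a = k*a + a := by ring
    rw [this]
    refine ⟨M.aux_int_add' ih.1 ha, ?_⟩
    rw [(M.aux_int_add ih.1 ha).1, ih.2]; ring

lemma aux_Nc_add {a b : ℕ} (ha : M.auxInt a) (hb : M.auxInt b) (v v' : ℕ) :
    M.NcCount a v * M.NcCount b v' ≤ M.NcCount (a+b) (v+v') := by
  have : ∏ t, M.Apoly t ^ M.cExp (a+b) t = (∏ t, M.Apoly t ^ M.cExp a t) * ∏ t, M.Apoly t ^ M.cExp b t := by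
    rw [← Finset.prod_mul_distrib]
    exact Finset.prod_congr rfl fun t _ => by rw [(M.aux_int_add ha hb).2.1 t, pow_add]
  unfold NcCount
  rw [this]
  exact aux_coeff_mul_geU _ _ (M.aux_PA_mem a) (M.aux_PA_mem b) _ _

lemma aux_Nv_add {a b : ℕ} (ha : M.auxInt a) (hb : M.auxInt b) (w w' v v' : ℕ) :
    M.NvCount a w v * M.NvCount b w' v' ≤ M.NvCount (a+b) (w+w') (v+v') := by
  have : ∏ t, M.Bpoly t ^ M.vExp (a+b) t = (∏ t, M.Bpoly t ^ M.vExp a t) * ∏ t, M.Bpoly t ^ M.vExp b t := by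
    rw [← Finset.prod_mul_distrib]
    exact Finset.prod_congr rfl fun t _ => by rw [(M.aux_int_add ha hb).2.2 t, pow_add]
  unfold NvCount
  rw [this]
  exact aux_coeff_mul_geB _ _ (M.aux_PB_mem a) (M.aux_PB_mem b) _ _ _ _

lemma aux_Nc_mul {a : ℕ} (ha : M.auxInt a) (k v b v' : ℕ) (hb : M.auxInt b) :
    M.NcCount a v ^ k * M.NcCount b v' ≤ M.NcCount (k*a+b) (k*v+v') := by
  induction k with
  | zero => simp
  | succ k ih =>
    have h1 : (k+1)*a + b= a + (k*a+b) := by ring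
    have h2 : (k+1)*v +v' = v + (k*v+v') := by ring
    rw [h1, h2]
    refine le_trans ?_ (M.aux_Nc_add ha (M.aux_int_add' (M.aux_int_mul ha k).1 hb) _ _)
    rw [pow_succ', mul_assoc]
    exact mul_le_mul_of_nonneg_left ih (M.aux_Nc_nonneg _ _)

lemma aux_Nv_mul {a : ℕ} (ha : M.auxInt a) (k w v b w' v' : ℕ) (hb : M.auxInt b) :
    M.NvCount a w v ^ k * M.NvCount b w' v' ≤ M.NvCount (k*a+b) (k*w+w') (k*v+v') := by
  induction k with
  | zero => simp
  | succ k ih =>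
    have h1 : (k+1)*a + b= a + (k*a+b) := by ring
    have h2 : (k+1)*v +v' = v + (k*v+v') := by ring
    have h3 : (k+1)*w +w' = w + (k*w+w') := by ring
    rw [h1, h2, h3]
    refine le_trans ?_ (M.aux_Nv_add ha (M.aux_int_add' (M.aux_int_mul ha k).1 hb) _ _ _ _)
    rw [pow_succ', mul_assoc]
    exact mul_le_mul_of_nonneg_left ih (M.aux_Nv_nonneg _ _ _)

lemma aux_term_le (n w v : ℕ) (hv : v ≤ M.En n) :
    M.NvCount n w v * M.NcCount n v / ((M.En n).choose v : ℝ) ≤ M.ENw n w := by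
  unfold ENw
  exact Finset.single_le_sum (f := fun v => M.NvCount n w v * M.NcCount n v / ((M.En n).choose v : ℝ))
    (fun v _ => div_nonneg (mul_nonneg (M.aux_Nv_nonneg _ _ _) (M.aux_Nc_nonneg _ _)) (Nat.cast_nonneg _))
    (Finset.mem_range.2 (by omega))

/-- maximal term extraction -/
lemma aux_max_term (n w : ℕ) (h : 0 < M.ENw n w) : ∃ v ≤ M.En n, 0 < M.NvCount n w v ∧ 0 < M.NcCount n v ∧
    Real.log (M.ENw n w) ≤ Real.log ((M.En n:ℝ) + 1) + (Real.log (M.NvCount n w v) + Real.log (M.NcCount n v)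
      - Real.log ((M.En n).choose v : ℝ)) := by
  obtain ⟨v, hv, hle⟩ : ∃ v ∈ range (M.En n + 1), M.ENw n w / ((M.En n:ℝ)+1) ≤
      M.NvCount n w v * M.NcCount n v / ((M.En n).choose v : ℝ) := by
    refine Finset.exists_le_of_sum_le (by simp) ?_
    rw [Finset.sum_const, Finset.card_range, nsmul_eq_mul]
    push_cast
    rw [mul_div_cancel₀ _ (by positivity)]
    exact le_rfl
  have hv' : v ≤ M.En n := by rw [Finset.mem_range] at hv; omega
  have hpos : 0 < M.ENw n w / ((M.En n:ℝ)+1) := by positivity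
  have hc : (0:ℝ) < ((M.En n).choose v : ℝ) := by exact_mod_cast Nat.choose_pos hv'
  have hpos2 := hpos.trans_le hle
  have hpos3 : 0 < M.NvCount n w v * M.NcCount n v := by
    rwa [div_pos_iff_of_pos_right hc] at hpos2
  have h1 : 0 < M.NvCount n w v := lt_of_le_of_ne (M.aux_Nv_nonneg _ _ _) (by
    intro h; rw [← h, zero_mul] at hpos3; exact lt_irrefl _ hpos3)
  have h2 : 0 < M.NcCount n v := lt_of_le_of_ne (M.aux_Nc_nonneg _ _) (by
    intro h; rw [← h, mul_zero] at hpos3; exact lt_irrefl _ hpos3)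
  refine ⟨v, hv', h1, h2, ?_⟩
  have := Real.log_le_log hpos hle
  rw [Real.log_div h.ne' (by positivity), Real.log_div hpos3.ne' hc.ne', Real.log_mul h1.ne' h2.ne'] at this
  linarith

lemma aux_term_log_le (n w v : ℕ) (hv : v ≤ M.En n) (x y : ℝ) (hx : 0 < x) (hy : 0 < y)
   (h1 : x ≤ M.NvCount n w v) (h2 : y ≤ M.NcCount n v) : 0 < M.ENw n w ∧ 
    Real.log x + Real.log y - Real.log ((M.En n).choose v : ℝ) ≤ Real.log (M.ENw n w) := by
  have hc : (0:ℝ) < ((M.En n).choose v : ℝ) := by exact_mod_cast Nat.choose_pos hv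
  have h3 : x * y / ((M.En n).choose v : ℝ) ≤ M.ENw n w := by
    refine le_trans ?_ (M.aux_term_le n w v hv)
    have := M.aux_Nv_nonneg n w v
    gcongr
  have hp : 0 < x * y / ((M.En n).choose v : ℝ) := by positivity
  refine ⟨hp.trans_le h3, ?_⟩
  have := Real.log_le_log hp h3
  rwa [Real.log_div (by positivity) hc.ne', Real.log_mul hx.ne' hy.ne'] at this

lemma aux_En_eq {n : ℕ} (h : M.auxInt n) : (M.En n : ℝ) * M.intlam = n := by
  rw [h.1]; field_simp [M.aux_intlam_pos.ne']

lemma aux_v_bounds {n w v : ℕ} (h : 0 < M.NvCount n w v) : v ≤ M.auxD * w ∧ w ≤ M.auxD * v :=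
  M.aux_PB_supp n w v h.ne'

lemma aux_fekete_class (α : ℝ) (hα : 0 < α) (hsm : M.auxD * α * M.intlam < 1) (n0 : ℕ) (h0 : M.Adm α n0) (c : ℕ) :
    ∃ K : ℝ, ∀ n, n % n0 = c → M.Adm α n → 
      (n:ℝ) * ((Real.log (M.ENw n0 ⌊α * (n0 : ℝ)⌋₊) - (2 + 3 * Real.log ((M.En n0:ℝ)+1))) / n0) - K
        ≤ Real.log (M.ENw n ⌊α * (n : ℝ)⌋₊) := by
  by_cases hex : ∃ n, n % n0 = c ∧ M.Adm α n
  swap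
  · refine ⟨0, fun n h1 h2 => (hex ⟨n, h1, h2⟩).elim⟩
  classical
  set n' := Nat.find hex with hn'
  obtain ⟨hc', ha'⟩ := Nat.find_spec hex
  rw [← hn'] at hc' ha'
  rw [aux_Adm_iff] at ha' h0
  obtain ⟨hpos0, hI0, hw0, hE0⟩ := h0
  obtain ⟨hpos', hI', hw', hE'⟩ := ha'
  set w0 := ⌊α * (n0 : ℝ)⌋₊ with hw0d
  set w' := ⌊α * (n' : ℝ)⌋₊ with hw'd
  obtain ⟨v0, hv0, hNv0, hNc0, hlog0⟩ := M.aux_max_term n0 w0 hE0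
  obtain ⟨v', hv', hNv', hNc', hlog'⟩ := M.aux_max_term n' w' hE'
  have hn0R : (0:ℝ) < n0 := by exact_mod_cast hpos0
  have hw0pos : 0 < w0 := by
    have : (0:ℝ) < w0 := by rw [hw0]; positivity
    exact_mod_cast this
  have hv0pos : 0 < v0 := by
    have := (M.aux_v_bounds hNv0).2
    rcases Nat.eq_zero_or_pos v0 with h | h
    · subst h; omega
    · exact h
  have hEpos : (0:ℝ) < M.En n0 := by
    have := M.aux_En_eq hI0
    have h2 := M.aux_intlam_pos
    by_contra h; push Not at h; nlinarith
  have hvlt : (v0:ℝ) < M.En n0 := by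
    have h1 : (v0:ℝ) ≤ M.auxD * w0 := by exact_mod_cast (M.aux_v_bounds hNv0).1
    rw [hw0, ← M.aux_En_eq hI0] at h1
    nlinarith
  set p : ℝ := v0 / M.En n0 with hp
  have hv0R : (0:ℝ) < v0 := by exact_mod_cast hv0pos
  have hp0 : 0 < p := by positivity
  have hp1 : p < 1 := by rw [hp, div_lt_one hEpos]; exact hvlt
  have hch0 := aux_log_choose_lower (M.En n0) v0 hv0
  have hlp : Real.log p = Real.log v0 - Real.log (M.En n0) := Real.log_div hv0R.ne' hEpos.ne'
  have hlp1 : Real.log (1-p) = Real.log ((M.En n0:ℝ) - v0) - Real.log (M.En n0) := by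
    rw [← Real.log_div (by linarith) hEpos.ne']
    congr 1; rw [hp]; field_simp
  set c0 := Real.log (M.ENw n0 w0) - (2 + 3 * Real.log ((M.En n0:ℝ)+1)) with hc0
  set K1 : ℝ := Real.log (M.NvCount n' w' v') + Real.log (M.NcCount n' v')
      + (v' * Real.log p) + ((M.En n':ℝ) - v') * Real.log (1-p) with hK1
  refine ⟨(n':ℝ) * (c0 / n0) - K1, fun n hn hadm => ?_⟩
  rw [aux_Adm_iff] at hadm
  obtain ⟨hpn, hIn, hwn, hEn⟩ := hadm
  have hle : n' ≤ n := Nat.find_min' hex ⟨hn, by rw [aux_Adm_iff]; exact ⟨hpn, hIn, hwn, hEn⟩⟩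
  obtain ⟨k, hk⟩ : ∃ k, n = k * n0 + n' := by
    have : n' ≡ n [MOD n0] := by rw [Nat.ModEq, hc', hn]
    have h2 := (Nat.modEq_iff_dvd' hle).1 this
    obtain ⟨k, hk⟩ := h2
    exact ⟨k, by rw [mul_comm, ← hk]; omega⟩
  have hwk : ⌊α * (n : ℝ)⌋₊ = k * w0 + w' := by
    have : ((⌊α * (n : ℝ)⌋₊ : ℕ) : ℝ) = ((k * w0 + w' : ℕ):ℝ) := by
      rw [hwn, hk]; push_cast; rw [hw0, hw']; ring
    exact_mod_cast this
  rw [hwk]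
  have hIk := M.aux_int_mul hI0 k
  have hEk : M.En n = k * M.En n0 + M.En n' := by
    rw [hk, (M.aux_int_add hIk.1 hI').1, hIk.2]
  have hvle : k * v0 + v' ≤ M.En n := by
    rw [hEk]; exact Nat.add_le_add (Nat.mul_le_mul_left k hv0) hv'
  have hT := (M.aux_term_log_le n (k*w0+w') (k*v0+v') hvle
    (M.NvCount n0 w0 v0 ^ k * M.NvCount n' w' v') (M.NcCount n0 v0 ^ k * M.NcCount n' v')
    (by positivity) (by positivity)
    (by rw [hk]; exact M.aux_Nv_mul hI0 k w0 v0 n' w' v' hI')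
    (by rw [hk]; exact M.aux_Nc_mul hI0 k v0 n' v' hI')).2
  refine le_trans ?_ hT
  have hcu := aux_log_choose_upper (M.En n) (k*v0+v') hvle p hp0 hp1
  rw [Real.log_mul (by positivity) (by positivity), Real.log_mul (by positivity) (by positivity),
    Real.log_pow, Real.log_pow]
  rw [hEk] at hcu ⊢
  push_cast at hcu
  have e1 : (n:ℝ) * (c0/n0) - ((n':ℝ) * (c0 / n0) - K1) = k * c0 + K1 := by
    rw [hk]; push_cast; field_simp; ring
  rw [e1]
  have e2 : c0 ≤ Real.log (M.NvCount n0 w0 v0) + Real.log (M.NcCount n0 v0) + v0 * Real.log p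
      + ((M.En n0:ℝ) - v0) * Real.log (1-p) := by
    rw [hlp, hlp1, hc0]
    linarith
  have e3 := mul_le_mul_of_nonneg_left e2 (Nat.cast_nonneg k : (0:ℝ) ≤ k)
  rw [hK1]
  linarith

lemma aux_fekete (α : ℝ) (hα : 0 < α) (hsm : M.auxD * α * M.intlam < 1) (n0 : ℕ) (h0 : M.Adm α n0) :
    ∃ K : ℝ, ∀ n, M.Adm α n → 
      (n:ℝ) * ((Real.log (M.ENw n0 ⌊α * (n0 : ℝ)⌋₊) - (2 + 3 * Real.log ((M.En n0:ℝ)+1))) / n0) - K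
        ≤ Real.log (M.ENw n ⌊α * (n : ℝ)⌋₊) := by
  choose K hK using M.aux_fekete_class α hα hsm n0 h0
  refine ⟨∑ c ∈ range n0, |K c|, fun n hn => ?_⟩
  have h1 := hK (n % n0) n rfl hn
  have h2 : K (n % n0) ≤ ∑ c ∈ range n0, |K c| :=
    (le_abs_self _).trans (Finset.single_le_sum (f := fun c => |K c|) (fun _ _ => abs_nonneg _)
      (Finset.mem_range.2 (Nat.mod_lt _ h0.1)))
  linarith

end DGLDPC


lemma aux_rpow_bd {b κ α e ξ : ℝ} (hb : 0 < b) (hκ : 0 < κ) (hα : 0 < α) (hα1 : α ≤ 1) (hbk : b ≤ κ * α)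
    (he : 0 ≤ e) (hξ : ξ ≤ e) : b ^ e ≤ κ ^ e * α ^ ξ := by
  calc b ^ e ≤ (κ * α) ^ e := Real.rpow_le_rpow hb.le hbk he
    _ = κ ^ e * α ^ e := Real.mul_rpow hκ.le hα.le
    _ ≤ κ ^ e * α ^ ξ := mul_le_mul_of_nonneg_left (Real.rpow_le_rpow_of_exponent_ge hα hα1 hξ)
        (Real.rpow_nonneg hκ.le _)

namespace DGLDPC
variable (M : DGLDPC)

lemma aux_evalA (t) (z : ℝ) : (M.Apoly t).eval z = ∑ u ∈ range (M.s t + 1), (M.A t u : ℝ) * z ^ u := by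
  unfold Apoly
  rw [eval_finsetSum]
  simp

lemma aux_evalB (t) (x y : ℝ) : ((M.Bpoly t).eval (C x)).eval y =
    1 + ∑ p ∈ M.auxS.filter (fun p => p.1 = t), (M.B p.1 p.2.1 p.2.2 : ℝ) * x ^ p.2.1 * y ^ p.2.2 := by
  have h1 : ((M.Bpoly t).eval (C x)).eval y =
      ∑ i ∈ range (M.kdim t + 1), ∑ j ∈ range (M.q t + 1), (M.B t i j : ℝ) * x ^ i * y ^ j := by
    unfold Bpoly
    simp only [eval_finsetSum, eval_mul, eval_C, eval_pow, eval_X]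
    refine Finset.sum_congr rfl fun i _ => ?_
    rw [Finset.sum_mul]
    exact Finset.sum_congr rfl fun j _ => by ring
  have h2 := M.aux_sum_triple (fun t i j => (M.B t i j : ℝ) * x ^ i * y ^ j - if (i,j) = (0,0) then 1 else 0) (by
    intro t i j h
    rw [aux_mem_S] at h
    by_cases h0 : (i,j) = (0,0)
    · simp only [Prod.mk.injEq] at h0; obtain ⟨rfl, rfl⟩ := h0; simp [M.hB00]
    · have : M.B t i j = 0 := by
        rcases Nat.eq_zero_or_pos (M.B t i j) with h' | h'
        · exact h'
        · exact (h ⟨h', h0⟩).elim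
      simp only [this, if_neg h0]; simp) t
  simp only [Finset.sum_sub_distrib] at h2
  rw [h1]
  have h3 : ∑ i ∈ range (M.kdim t + 1), ∑ j ∈ range (M.q t + 1), (if (i,j) = (0,0) then (1:ℝ) else 0) = 1 := by
    rw [← Finset.sum_product' (f := fun i j => if (i,j) = (0,0) then (1:ℝ) else 0)]
    simp
  have h4 : ∑ p ∈ M.auxS.filter (fun p => p.1 = t), (if (p.2.1,p.2.2) = (0,0) then (1:ℝ) else 0) = 0 := by
    refine Finset.sum_eq_zero fun p hp => ?_
    rw [if_neg]
    exact ((M.aux_mem_S p).1 (Finset.mem_filter.1 hp).1).2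
  rw [h3, h4] at h2
  linarith

/-- constant for the check part -/
noncomputable def auxKA (κ : ℝ) : ℝ := ∑ t, M.ρ t / (M.s t : ℝ) * ∑ u ∈ range (M.s t + 1), (M.A t u : ℝ) * (κ / M.Cparam) ^ ((u:ℝ)/M.r)

lemma aux_A_bound {κ α b z : ℝ} (hκ : 0 < κ) (hα : 0 < α) (hα1 : α ≤ 1) (hb : 0 < b) (hbk : b ≤ κ * α)
    (hz : z = (b / M.Cparam) ^ (1 / (M.r:ℝ))) :
    ∑ t, M.ρ t / (M.s t:ℝ) * ((M.Apoly t).eval z - 1) ≤ b / M.r + M.auxKA κ * α ^ M.ξexp := by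
  have hC := M.aux_C_pos
  have hr := M.aux_r2R
  have hr0 : (0:ℝ) < M.r := by linarith
  have hz0 : 0 < z := by rw [hz]; exact Real.rpow_pos_of_pos (by positivity) _
  have hzu : ∀ u : ℕ, z ^ u = (b / M.Cparam) ^ ((u:ℝ) / M.r) := by
    intro u
    rw [hz, ← Real.rpow_natCast, ← Real.rpow_mul (by positivity)]
    congr 1; ring
  have hzr : z ^ M.r = b / M.Cparam := by
    rw [hzu, div_self hr0.ne', Real.rpow_one]
  have hαξ : 0 < α ^ M.ξexp := Real.rpow_pos_of_pos hα _
  have key : ∀ t, (M.Apoly t).eval z - 1 ≤ (M.A t M.r : ℝ) * (b / M.Cparam) +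
      (∑ u ∈ range (M.s t + 1), (M.A t u : ℝ) * (κ / M.Cparam) ^ ((u:ℝ)/M.r)) * α ^ M.ξexp := by
    intro t
    rw [aux_evalA]
    have h1 : ∑ u ∈ range (M.s t + 1), (M.A t u : ℝ) * z ^ u ≤ ∑ u ∈ range (M.s t + 1), 
       ((if u = 0 then 1 else 0) + (if u = M.r then (M.A t M.r : ℝ) * (b / M.Cparam) else 0)
        + (M.A t u : ℝ) * (κ / M.Cparam) ^ ((u:ℝ)/M.r) * α ^ M.ξexp) := by
      refine Finset.sum_le_sum fun u _ => ?_
      have hn : 0 ≤ (M.A t u : ℝ) * (κ / M.Cparam) ^ ((u:ℝ)/M.r) * α ^ M.ξexp := by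
        have : 0 ≤ (κ / M.Cparam) ^ ((u:ℝ)/M.r) := Real.rpow_nonneg (by positivity) _
        positivity
      have hr2 := M.aux_r2
      rcases Nat.lt_trichotomy u M.r with h | h | h
      · rcases Nat.eq_zero_or_pos u with h0 | h0
        · subst h0
          rw [if_pos rfl, if_neg (by omega), M.hA0]
          rw [M.hA0] at hn
          simp only [Nat.cast_one, pow_zero, mul_one] at hn ⊢
          linarith
        · rw [if_neg (by omega), if_neg (by omega), M.hAsupp t u (by omega) (Or.inl (by have := M.aux_r_le t; omega))]
          simp
      · rw [if_neg (by omega), if_pos h, h, hzr]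
        rw [h] at hn
        linarith
      · rw [if_neg (by omega), if_neg (by omega), zero_add, zero_add]
        rcases Nat.eq_zero_or_pos (M.A t u) with h0 | h0
        · rw [h0]; simp
        · have hx := M.aux_xi_leA h h0
          rw [hzu, mul_assoc]
          refine mul_le_mul_of_nonneg_left ?_ (Nat.cast_nonneg _)
          exact aux_rpow_bd (by positivity) (by positivity) hα hα1 (by
            rw [div_mul_eq_mul_div]; gcongr) (by positivity) hx
    rw [Finset.sum_add_distrib, Finset.sum_add_distrib, ← Finset.sum_mul] at h1
    have h2 : ∑ u ∈ range (M.s t + 1), (if u = 0 then (1:ℝ) else 0) = 1 := by simp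
    have h3 : ∑ u ∈ range (M.s t + 1), (if u = M.r then (M.A t M.r : ℝ) * (b / M.Cparam) else 0)
        ≤ (M.A t M.r : ℝ) * (b / M.Cparam) := by
      rw [Finset.sum_ite_eq']
      split_ifs
      · exact le_rfl
      · positivity
    linarith
  calc _ ≤ ∑ t, M.ρ t / (M.s t:ℝ) * ((M.A t M.r : ℝ) * (b / M.Cparam) +
      (∑ u ∈ range (M.s t + 1), (M.A t u : ℝ) * (κ / M.Cparam) ^ ((u:ℝ)/M.r)) * α ^ M.ξexp) :=
        Finset.sum_le_sum fun t _ => mul_le_mul_of_nonneg_left (key t) (M.aux_rs_pos t).le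
    _ = (∑ t, M.ρ t / (M.s t:ℝ) * (M.A t M.r : ℝ)) * (b / M.Cparam) + M.auxKA κ * α ^ M.ξexp := by
        unfold auxKA
        rw [Finset.sum_mul, Finset.sum_mul, ← Finset.sum_add_distrib]
        exact Finset.sum_congr rfl fun t _ => by ring
    _ = _ := by
        congr 1
        have := M.aux_C_eq
        have h2 : ∑ t, M.ρ t / (M.s t:ℝ) * (M.A t M.r : ℝ) = M.Cparam / M.r := by
          rw [this]; field_simp
        rw [h2]; field_simp

lemma aux_Nc_upper {n v : ℕ} (hI : M.auxInt n) (hN : 0 < M.NcCount n v) {z : ℝ} (hz : 0 < z) :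
    Real.log (M.NcCount n v) ≤ M.En n * (∑ t, M.ρ t / (M.s t:ℝ) * ((M.Apoly t).eval z - 1)) - v * Real.log z := by
  have h1 := aux_chernU _ (M.aux_PA_mem n) z hz.le v
  rw [eval_prod] at h1
  have hexp : ∏ t, ((M.Apoly t ^ M.cExp n t).eval z) ≤ Real.exp (M.En n * (∑ t, M.ρ t / (M.s t:ℝ) * ((M.Apoly t).eval z - 1))) := by
    rw [Finset.mul_sum, Real.exp_sum]
    refine Finset.prod_le_prod (fun t _ => ?_) (fun t _ => ?_)
    · rw [eval_pow, aux_evalA]; positivity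
    · rw [eval_pow]
      have : (M.En n:ℝ) * (M.ρ t / (M.s t:ℝ) * ((M.Apoly t).eval z - 1)) = (M.cExp n t : ℝ) * ((M.Apoly t).eval z - 1) := by
        rw [hI.2.1 t]; ring
      rw [this, Real.exp_nat_mul]
      refine pow_le_pow_left₀ ?_ ?_ _
      · rw [aux_evalA]; positivity
      · have := Real.add_one_le_exp ((M.Apoly t).eval z - 1); linarith
  have h2 : M.NcCount n v * z ^ v ≤ _ := h1.trans hexp
  have h3 := Real.log_le_log (by positivity) h2
  rw [Real.log_exp, Real.log_mul hN.ne' (by positivity), Real.log_pow] at h3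
  linarith

lemma aux_Nv_upper {n w v : ℕ} (hI : M.auxInt n) (hN : 0 < M.NvCount n w v) {x y : ℝ} (hx : 0 < x) (hy : 0 < y) :
    Real.log (M.NvCount n w v) ≤ M.En n * (∑ p ∈ M.auxS, M.lam p.1 / (M.q p.1:ℝ) * ((M.B p.1 p.2.1 p.2.2 : ℝ) * x ^ p.2.1 * y ^ p.2.2))
       - w * Real.log x - v * Real.log y := by
  have h1 := aux_chernB _ (M.aux_PB_mem n) x y hx.le hy.le w v
  rw [eval_prod, eval_prod] at h1
  have hexp : ∏ t, (((M.Bpoly t ^ M.vExp n t).eval (C x)).eval y) ≤ Real.exp (M.En n * (∑ p ∈ M.auxS, M.lam p.1 / (M.q p.1:ℝ) * ((M.B p.1 p.2.1 p.2.2 : ℝ) * x ^ p.2.1 * y ^ p.2.2))) := by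
    rw [← Finset.sum_fiberwise M.auxS (fun p => p.1), Finset.mul_sum, Real.exp_sum]
    refine Finset.prod_le_prod (fun t _ => ?_) (fun t _ => ?_)
    · rw [eval_pow, eval_pow, aux_evalB]; positivity
    · rw [eval_pow, eval_pow]
      have : (M.En n:ℝ) * (∑ p ∈ M.auxS.filter (fun p => p.1 = t), M.lam p.1 / (M.q p.1:ℝ) * ((M.B p.1 p.2.1 p.2.2 : ℝ) * x ^ p.2.1 * y ^ p.2.2)) = (M.vExp n t : ℝ) * (((M.Bpoly t).eval (C x)).eval y - 1) := by
        rw [hI.2.2 t, aux_evalB, add_sub_cancel_left, mul_div_assoc, mul_assoc]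
        congr 1
        rw [Finset.mul_sum]
        refine Finset.sum_congr rfl fun p hp => ?_
        rw [(Finset.mem_filter.1 hp).2]
      rw [this, Real.exp_nat_mul]
      refine pow_le_pow_left₀ ?_ ?_ _
      · rw [aux_evalB]; positivity
      · have := Real.add_one_le_exp (((M.Bpoly t).eval (C x)).eval y - 1); linarith
  have h2 : M.NvCount n w v * x ^ w * y ^ v ≤ _ := h1.trans hexp
  have h3 := Real.log_le_log (by positivity) h2
  rw [Real.log_exp, Real.log_mul (by positivity) (by positivity), Real.log_mul hN.ne' (by positivity), Real.log_pow, Real.log_pow] at h3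
  linarith

noncomputable def auxKB (κ y0 : ℝ) : ℝ := ∑ p ∈ M.auxS, M.auxc y0 p * κ ^ ((M.Tij p.2.1 p.2.2 - M.T) * (p.2.1 : ℝ) / M.ψ + 1)

lemma aux_B_bound {κ α b x y y0 : ℝ} (hκ : 0 < κ) (hα : 0 < α) (hα1 : α ≤ 1) (hb : 0 < b) (hbk : b ≤ κ * α)
    (hy0 : 0 < y0) (hQ : M.Q1 y0 = 1)
    (hx : x = y0 * (M.intlam / Real.exp 1) ^ (M.T / M.ψ) * b ^ (- (M.T / M.ψ)))
    (hy : y = M.Cparam ^ (1 / (M.r:ℝ)) * b ^ (1 / M.ψ)) :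
    (∑ p ∈ M.auxS, M.lam p.1 / (M.q p.1:ℝ) * ((M.B p.1 p.2.1 p.2.2 : ℝ) * x ^ p.2.1 * y ^ p.2.2)) ≤
      b * ((1 - M.T * M.Q2 y0) / M.ψ) + M.auxKB κ y0 * α ^ M.ξexp := by
  have hC := M.aux_C_pos
  have hψ := M.aux_psi_pos
  have hil : 0 < M.intlam / Real.exp 1 := div_pos M.aux_intlam_pos (Real.exp_pos 1)
  have hterm : ∀ p ∈ M.auxS, M.lam p.1 / (M.q p.1:ℝ) * ((M.B p.1 p.2.1 p.2.2 : ℝ) * x ^ p.2.1 * y ^ p.2.2)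
      = M.auxc y0 p * b ^ ((M.Tij p.2.1 p.2.2 - M.T) * (p.2.1 : ℝ) / M.ψ + 1) := by
    intro p hp
    unfold auxc
    have e1 : (M.Tij p.2.1 p.2.2 - M.T) * (p.2.1 : ℝ) / M.ψ + 1 = -(M.T/M.ψ) * (p.2.1:ℝ) + (1/M.ψ) * (p.2.2:ℝ) := by
      rw [M.aux_Tij_mul hp]; field_simp; ring
    rw [e1, Real.rpow_add hb, Real.rpow_mul hb.le, Real.rpow_mul hb.le, hx, hy, mul_pow, mul_pow, mul_pow,
      Real.rpow_natCast, Real.rpow_natCast]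
    have e2 : M.Cparam ^ ((p.2.2 : ℝ) / (M.r : ℝ)) = (M.Cparam ^ (1 / (M.r:ℝ))) ^ p.2.2 := by
      rw [← Real.rpow_natCast, ← Real.rpow_mul hC.le]; congr 1; ring
    have e3 : (M.intlam / Real.exp 1) ^ ((p.2.1 : ℝ) * M.T / M.ψ) = ((M.intlam / Real.exp 1) ^ (M.T / M.ψ)) ^ p.2.1 := by
      rw [← Real.rpow_natCast, ← Real.rpow_mul hil.le]; congr 1; ring
    rw [e2, e3]; ring
  have hαξ : 0 < α ^ M.ξexp := Real.rpow_pos_of_pos hα _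
  have hsum := M.aux_sum_c y0
  rw [hQ] at hsum
  rw [← hsum]
  unfold auxKB
  have hPe : ∑ p ∈ M.auxP, M.auxc y0 p = ∑ p ∈ M.auxS, if M.Tij p.2.1 p.2.2 = M.T then M.auxc y0 p else 0 := by
    unfold auxP; rw [Finset.sum_filter]
  rw [hPe, Finset.mul_sum, Finset.sum_mul, ← Finset.sum_add_distrib]
  refine Finset.sum_le_sum fun p hp => ?_
  rw [hterm p hp]
  have hc := M.aux_c_pos hy0 hp
  have hkn : 0 ≤ M.auxc y0 p * κ ^ ((M.Tij p.2.1 p.2.2 - M.T) * (p.2.1 : ℝ) / M.ψ + 1) * α ^ M.ξexp := by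
    have : 0 ≤ κ ^ ((M.Tij p.2.1 p.2.2 - M.T) * (p.2.1 : ℝ) / M.ψ + 1) := Real.rpow_nonneg hκ.le _
    positivity
  split_ifs with h
  · have e : b ^ ((M.Tij p.2.1 p.2.2 - M.T) * (p.2.1 : ℝ) / M.ψ + 1) = b := by rw [h]; simp
    rw [e]; linarith
  · rw [mul_zero, zero_add, mul_assoc]
    refine mul_le_mul_of_nonneg_left ?_ hc.le
    have hP : p ∉ M.auxP := fun h' => h (Finset.mem_filter.1 h').2
    refine aux_rpow_bd hb hκ hα hα1 hbk ?_ (M.aux_xi_leB hp hP)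
    have : 0 ≤ M.Tij p.2.1 p.2.2 - M.T := by linarith [M.aux_T_le hp]
    positivity

/-- main term -/
noncomputable def auxMain (y α : ℝ) : ℝ := (M.T / M.ψ) * α * Real.log α +
                α * (Real.log (1 / y) + (M.T / M.ψ) * Real.log (1 / M.Q2 y))

lemma aux_term_upper {κ α y0 : ℝ} (hκ : 0 < κ) (hκD : M.auxD * M.intlam ≤ κ) (hα : 0 < α) (hα1 : α ≤ 1)
    (hy0 : 0 < y0) (hQ : M.Q1 y0 = 1) {n w v : ℕ} (hn : 0 < n) (hI : M.auxInt n) (hw : (w:ℝ) = α * n)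
    (hv : v ≤ M.En n) (hNv : 0 < M.NvCount n w v) (hNc : 0 < M.NcCount n v) :
    Real.log (M.NvCount n w v) + Real.log (M.NcCount n v) - Real.log ((M.En n).choose v : ℝ) ≤
      n * M.auxMain y0 α + M.En n * ((M.auxKA κ + M.auxKB κ y0 + κ^2) * α ^ M.ξexp)
        + (2 + 2 * Real.log ((M.En n:ℝ)+1)) := by
  have hnR : (0:ℝ) < n := by exact_mod_cast hn
  have hil := M.aux_intlam_pos
  have hC := M.aux_C_pos
  have hψ := M.aux_psi_pos
  have hr := M.aux_r2R
  have hr0 : (0:ℝ) < M.r := by linarith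
  have hEn := M.aux_En_eq hI
  have hE : (0:ℝ) < M.En n := by
    by_contra h; push Not at h; nlinarith
  set E : ℝ := (M.En n : ℝ) with hEd
  have hwpos : (0:ℝ) < w := by rw [hw]; positivity
  have hvpos : 0 < v := by
    have h1 := (M.aux_v_bounds hNv).2
    rcases Nat.eq_zero_or_pos v with h | h
    · subst h
      have : 0 < w := by exact_mod_cast hwpos
      omega
    · exact h
  have hvR : (0:ℝ) < v := by exact_mod_cast hvpos
  obtain ⟨b, hbd⟩ : ∃ b : ℝ, b = v / E := ⟨_, rfl⟩
  have hvb : (v:ℝ) = E * b := by rw [hbd]; field_simp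
  have hb : 0 < b := by rw [hbd]; positivity
  have hb1 : b ≤ 1 := by
    rw [hbd, div_le_one hE, hEd]; exact_mod_cast hv
  have hbk : b ≤ κ * α := by
    have h1 : (v:ℝ) ≤ M.auxD * w := by exact_mod_cast (M.aux_v_bounds hNv).1
    rw [hw, ← hEn, hvb] at h1
    have h2 : E * b ≤ E * (M.auxD * M.intlam * α) := by linarith
    have h3 := le_of_mul_le_mul_left h2 hE
    exact h3.trans (by gcongr)
  -- CN
  obtain ⟨z, hz⟩ : ∃ z : ℝ, z = (b / M.Cparam) ^ (1 / (M.r:ℝ)) := ⟨_, rfl⟩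
  have hz0 : 0 < z := by rw [hz]; exact Real.rpow_pos_of_pos (by positivity) _
  have hlz : Real.log z = (1/(M.r:ℝ)) * (Real.log b - Real.log M.Cparam) := by
    rw [hz, Real.log_rpow (by positivity), Real.log_div hb.ne' hC.ne']
  have hA := (M.aux_Nc_upper hI hNc hz0).trans (sub_le_sub_right (mul_le_mul_of_nonneg_left
    (M.aux_A_bound hκ hα hα1 hb hbk hz) hE.le) _)
  -- VN
  obtain ⟨x, hx⟩ : ∃ x : ℝ, x = y0 * (M.intlam / Real.exp 1) ^ (M.T / M.ψ) * b ^ (- (M.T / M.ψ)) := ⟨_, rfl⟩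
  obtain ⟨y, hy⟩ : ∃ y : ℝ, y = M.Cparam ^ (1 / (M.r:ℝ)) * b ^ (1 / M.ψ) := ⟨_, rfl⟩
  have hile : 0 < M.intlam / Real.exp 1 := div_pos M.aux_intlam_pos (Real.exp_pos 1)
  have p1 := Real.rpow_pos_of_pos hile (M.T / M.ψ)
  have p2 := Real.rpow_pos_of_pos hb (-(M.T / M.ψ))
  have p3 := Real.rpow_pos_of_pos hC (1 / (M.r:ℝ))
  have p4 := Real.rpow_pos_of_pos hb (1 / M.ψ)
  have hx0 : 0 < x := by rw [hx]; positivity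
  have hy0' : 0 < y := by rw [hy]; positivity
  have hlx : Real.log x = Real.log y0 + (M.T / M.ψ) * (Real.log M.intlam - 1) - (M.T/M.ψ) * Real.log b := by
    rw [hx, Real.log_mul (by positivity) p2.ne', Real.log_mul hy0.ne' p1.ne', Real.log_rpow hile, Real.log_rpow hb,
      Real.log_div hil.ne' (Real.exp_pos 1).ne', Real.log_exp]; ring
  have hly : Real.log y = (1/(M.r:ℝ)) * Real.log M.Cparam + (1/M.ψ) * Real.log b := by
    rw [hy, Real.log_mul p3.ne' p4.ne', Real.log_rpow hC, Real.log_rpow hb]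
  have hB := (M.aux_Nv_upper hI hNv hx0 hy0').trans (sub_le_sub_right (sub_le_sub_right (mul_le_mul_of_nonneg_left
    (M.aux_B_bound hκ hα hα1 hb hbk hy0 hQ hx hy) hE.le) _) _)
  -- choose
  have hch := aux_log_choose_lower (M.En n) v hv
  rw [← hEd] at hch
  have hch2 : E * Real.log E - v * Real.log v - (E - v) * Real.log (E - v) ≥ - (v * Real.log b) + E * (b - b^2) := by
    have e1 : Real.log v = Real.log E + Real.log b := by rw [hvb, Real.log_mul hE.ne' hb.ne']
    have e2 : (E - v) * Real.log (E - v) ≤ (E - v) * (Real.log E - b) := by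
      rcases hb1.lt_or_eq with h | h
      · have h' : 0 < 1 - b := by linarith
        have e3 : E - v = E * (1 - b) := by rw [hvb]; ring
        have e4 : Real.log (E - v) = Real.log E + Real.log (1-b) := by rw [e3, Real.log_mul hE.ne' h'.ne']
        rw [e4]
        have e5 : Real.log (1-b) ≤ -b := by have := Real.log_le_sub_one_of_pos h'; linarith
        refine mul_le_mul_of_nonneg_left (by linarith) (by rw [e3]; positivity)
      · have : E - v = 0 := by rw [hvb, h]; ring
        rw [this]; simp
    have e6 : (E - v) * (Real.log E - b) = E * Real.log E - v * Real.log E - E * (b - b^2) := by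
      rw [hvb]; ring
    rw [e1]
    linarith
  have hαξ : 0 < α ^ M.ξexp := Real.rpow_pos_of_pos hα _
  have hb2 : b^2 ≤ κ^2 * α ^ M.ξexp := by
    have := aux_rpow_bd hb hκ hα hα1 hbk (by norm_num : (0:ℝ) ≤ 2) M.aux_xi_le2
    rwa [Real.rpow_two, Real.rpow_two] at this
  have hb2E := mul_le_mul_of_nonneg_left hb2 hE.le
  have hQ2 := M.aux_Q2_pos hy0
  -- concave optimization
  have hopt : w * Real.log b ≤ w * (Real.log α + Real.log M.intlam - Real.log (M.Q2 y0)) + E * b * M.Q2 y0 - w := by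
    have hwE : (w:ℝ) = E * (α * M.intlam) := by rw [hw, ← hEn]; ring
    have h1 := Real.log_le_sub_one_of_pos (show 0 < b * M.Q2 y0 / (α * M.intlam) by positivity)
    rw [Real.log_div (by positivity) (by positivity), Real.log_mul hb.ne' hQ2.ne', Real.log_mul hα.ne' hil.ne'] at h1
    have h2 := mul_le_mul_of_nonneg_left h1 hwpos.le
    have h3 : (w:ℝ) * (b * M.Q2 y0 / (α * M.intlam) - 1) = E * b * M.Q2 y0 - w := by
      rw [hwE]; field_simp
    rw [h3] at h2
    linarith
  have hTψ : 0 ≤ M.T / M.ψ := div_nonneg M.aux_T_nonneg hψ.le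
  have hopt2 := mul_le_mul_of_nonneg_left hopt hTψ
  have hmain : (n:ℝ) * M.auxMain y0 α = w * ((M.T / M.ψ) * Real.log α - Real.log y0 - (M.T/M.ψ) * Real.log (M.Q2 y0)) := by
    unfold auxMain
    rw [hw, one_div, one_div, Real.log_inv, Real.log_inv]; ring
  rw [hmain]
  rw [hlz] at hA
  rw [hlx, hly] at hB
  have hpsi := M.aux_psi_inv
  have e7 : (1 - M.T * M.Q2 y0) / M.ψ = 1/M.ψ - (M.T / M.ψ) * M.Q2 y0 := by ring
  rw [e7] at hB
  rw [hpsi] at hB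
  have e8 : b / M.r = (1/(M.r:ℝ)) * b := by ring
  rw [e8] at hA
  generalize M.T / M.ψ = τ at *
  generalize 1/(M.r:ℝ) = ι at *
  generalize α ^ M.ξexp = a at *
  rw [hvb] at hA hB hch hch2
  rw [hvb] at *
  linarith

lemma aux_upper {y0 : ℝ} (hy0 : 0 < y0) (hQ : M.Q1 y0 = 1) : ∃ K : ℝ, 0 < K ∧ ∀ α, 0 < α → α ≤ 1 → ∀ n, M.Adm α n →
    Real.log (M.ENw n ⌊α * (n : ℝ)⌋₊) ≤ n * (M.auxMain y0 α + K * α ^ M.ξexp) + (2 + 3 * Real.log ((M.En n:ℝ)+1)) := by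
  set κ : ℝ := M.auxD * M.intlam + 1 with hκ
  have hil := M.aux_intlam_pos
  have hκ0 : 0 < κ := by positivity
  refine ⟨|M.auxKA κ + M.auxKB κ y0 + κ^2| / M.intlam + 1, by positivity, fun α hα hα1 n hadm => ?_⟩
  rw [aux_Adm_iff] at hadm
  obtain ⟨hn, hI, hw, hE⟩ := hadm
  obtain ⟨v, hv, hNv, hNc, hlog⟩ := M.aux_max_term n _ hE
  have h1 := M.aux_term_upper hκ0 (by linarith) hα hα1 hy0 hQ hn hI hw hv hNv hNc
  have hαξ : 0 < α ^ M.ξexp := Real.rpow_pos_of_pos hα _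
  have h2 : (M.En n:ℝ) * ((M.auxKA κ + M.auxKB κ y0 + κ^2) * α ^ M.ξexp) ≤
      n * ((|M.auxKA κ + M.auxKB κ y0 + κ^2| / M.intlam + 1) * α ^ M.ξexp) := by
    rw [← mul_assoc, ← mul_assoc]
    refine mul_le_mul_of_nonneg_right ?_ hαξ.le
    calc (M.En n:ℝ) * (M.auxKA κ + M.auxKB κ y0 + κ^2) ≤ (M.En n:ℝ) * |M.auxKA κ + M.auxKB κ y0 + κ^2| := by
          gcongr; exact le_abs_self _
      _ = n * (|M.auxKA κ + M.auxKB κ y0 + κ^2| / M.intlam) := by rw [hI.1]; ring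
      _ ≤ _ := by gcongr; linarith
  linarith

end DGLDPC


lemma aux_cfg1 {R ι : Type*} [CommRing R] (S : Subsemiring R) (P : Finset ι) (g : ι → R)
    (hg : ∀ p ∈ P, g p ∈ S) (n : ι → ℕ) (N : ℕ) (hN : ∑ p ∈ P, n p < N) :
    ∃ c : ℕ, 0 < c ∧ (1 + ∑ p ∈ P, g p) ^ N - (c : R) * ∏ p ∈ P, g p ^ n p ∈ S ∧
      ∑ p ∈ P, ((n p : ℝ) * (Real.log ((N:ℝ) - ∑ p' ∈ P, (n p' : ℝ)) - Real.log (n p) + 1)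
        - (1 + Real.log ((n p:ℝ) + 1))) ≤ Real.log c := by
  set s := Finset.insertNone P with hs
  let g' : Option ι → R := fun o => o.elim 1 g
  let k' : Option ι → ℕ := fun o => o.elim (N - ∑ p ∈ P, n p) (fun p => if p ∈ P then n p else 0)
  have hsum : ∑ o ∈ s, k' o = N := by
    rw [hs, Finset.sum_insertNone]
    have : ∑ x ∈ P, k' (some x) = ∑ p ∈ P, n p := Finset.sum_congr rfl fun p hp => by simp [k', hp]
    rw [this]
    simp only [k', Option.elim]
    omega
  have h1 := aux_sum_pow_ge S s g' (by
      intro o ho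
      cases o with
      | none => exact one_mem _
      | some p => exact hg p (by simpa [hs] using ho)) k' (by
      intro o ho
      cases o with
      | none => simp [hs] at ho
      | some p => 
        have : p ∉ P := by simpa [hs] using ho
        simp [k', this]) N hsum
  have e1 : ∑ o ∈ s, g' o = 1 + ∑ p ∈ P, g p := by rw [hs, Finset.sum_insertNone]; rfl
  have e2 : ∏ o ∈ s, g' o ^ k' o = ∏ p ∈ P, g p ^ n p := by
    rw [hs, Finset.prod_insertNone]
    simp only [g', k', Option.elim, one_pow, one_mul]
    exact Finset.prod_congr rfl fun p hp => by rw [if_pos hp]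
  rw [e1, e2] at h1
  refine ⟨_, Nat.multinomial_pos _ _, h1, ?_⟩
  have h2 := Nat.multinomial_spec s k'
  rw [hsum, hs, Finset.prod_insertNone, ← hs] at h2
  have e3 : ∏ x ∈ P, (k' (some x)).factorial = ∏ p ∈ P, (n p).factorial :=
    Finset.prod_congr rfl fun p hp => by simp [k', hp]
  rw [e3] at h2
  simp only [k', Option.elim] at h2
  set c := Nat.multinomial s k' with hc
  have hc0 : 0 < c := Nat.multinomial_pos _ _
  have hc' : Nat.multinomial s (fun o => o.elim (N - ∑ p ∈ P, n p) (fun p => if p ∈ P then n p else 0)) = c := rfl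
  set Sg := ∑ p ∈ P, n p with hSg
  have h3 := Nat.factorial_mul_pow_sub_le_factorial (Nat.sub_le N Sg)
  have e4 : N - (N - Sg) = Sg := by omega
  rw [e4, ← h2, mul_assoc] at h3
  have h4 : (N - Sg) ^ Sg ≤ (∏ p ∈ P, (n p).factorial) * c := Nat.le_of_mul_le_mul_left h3 (Nat.factorial_pos _)
  have hpos : 0 < N - Sg := by omega
  have h5 : (((N - Sg : ℕ):ℝ)) ^ Sg ≤ (∏ p ∈ P, ((n p).factorial:ℝ)) * c := by exact_mod_cast h4
  have h6 := Real.log_le_log (by positivity) h5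
  have hf : ∀ p ∈ P, ((n p).factorial:ℝ) ≠ 0 := fun p _ => by positivity
  rw [Real.log_pow, Real.log_mul (Finset.prod_ne_zero_iff.2 hf) (by positivity), Real.log_prod hf] at h6
  have h7 : ∑ p ∈ P, Real.log ((n p).factorial:ℝ) ≤ ∑ p ∈ P, ((n p:ℝ) * Real.log (n p) - n p + 1 + Real.log ((n p:ℝ)+1)) :=
    Finset.sum_le_sum fun p _ => aux_log_fact_upper (n p)
  have e5 : ((N - Sg : ℕ):ℝ) = (N:ℝ) - ∑ p' ∈ P, (n p' : ℝ) := by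
    rw [Nat.cast_sub (by omega), hSg]; push_cast; ring
  have e6 : (Sg:ℝ) = ∑ p' ∈ P, (n p' : ℝ) := by rw [hSg]; push_cast; ring
  rw [e5] at h6
  generalize Real.log ((N:ℝ) - ∑ p' ∈ P, (n p' : ℝ)) = L at *
  rw [e6, Finset.sum_mul] at h6
  have e7 : ∑ p ∈ P, ((n p : ℝ) * (L - Real.log (n p) + 1) - (1 + Real.log ((n p:ℝ) + 1)))
     = ∑ p ∈ P, (n p:ℝ) * L - ∑ p ∈ P, ((n p:ℝ) * Real.log (n p) - n p + 1 + Real.log ((n p:ℝ)+1)) := by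
    rw [← Finset.sum_sub_distrib]; exact Finset.sum_congr rfl fun p _ => by ring
  rw [e7]; linarith

lemma aux_cfg {R ι κ : Type*} [CommRing R] [Fintype κ] [DecidableEq κ] (S : Subsemiring R) (P : Finset ι) (τ : ι → κ) (F : κ → R)
    (g : ι → R) (hg : ∀ p ∈ P, g p ∈ S) (hF : ∀ t, F t - (1 + ∑ p ∈ P with τ p = t, g p) ∈ S)
    (n : ι → ℕ) (N : κ → ℕ) (hN : ∀ t, ∑ p ∈ P with τ p = t, n p < N t) :
    ∃ c : ℕ, 0 < c ∧ ∏ t, F t ^ N t - (c : R) * ∏ p ∈ P, g p ^ n p ∈ S ∧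
      ∑ p ∈ P, ((n p : ℝ) * (Real.log ((N (τ p):ℝ) - ∑ p' ∈ P with τ p' = τ p, (n p' : ℝ)) - Real.log (n p) + 1)
        - (1 + Real.log ((n p:ℝ) + 1))) ≤ Real.log c := by
  have hg' : ∀ t, ∀ p ∈ P.filter (fun p => τ p = t), g p ∈ S := fun t p hp => hg p (Finset.mem_filter.1 hp).1
  choose c hc0 hcS hcl using fun t => aux_cfg1 S (P.filter (fun p => τ p = t)) g (hg' t) n (N t) (hN t)
  refine ⟨∏ t, c t, Finset.prod_pos fun t _ => hc0 t, ?_, ?_⟩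
  · have h1 := aux_prod_ge S Finset.univ (fun t => F t ^ N t) (fun t => (c t : R) * ∏ p ∈ P with τ p = t, g p ^ n p)
      (fun t _ => by
        have hm : 1 + ∑ p ∈ P with τ p = t, g p ∈ S := add_mem (one_mem _) (sum_mem (hg' t))
        have h2 := aux_prod_ge S (Finset.range (N t)) (fun _ => F t) (fun _ => 1 + ∑ p ∈ P with τ p = t, g p)
          (fun _ _ => hF t) (fun _ _ => hm)
        rw [Finset.prod_const, Finset.prod_const, Finset.card_range] at h2
        have := add_mem h2 (hcS t)
        rwa [sub_add_sub_cancel] at this)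
      (fun t _ => mul_mem (natCast_mem _ _) (prod_mem fun p hp => pow_mem (hg' t p hp) _))
    rw [Finset.prod_mul_distrib, Finset.prod_fiberwise P τ (fun p => g p ^ n p)] at h1
    push_cast
    exact h1
  · push_cast
    rw [Real.log_prod (fun t _ => by have := hc0 t; positivity)]
    refine le_trans (le_of_eq ?_) (Finset.sum_le_sum fun t _ => hcl t)
    rw [← Finset.sum_fiberwise P τ]
    refine Finset.sum_congr rfl fun t _ => Finset.sum_congr rfl fun p hp => ?_
    rw [(Finset.mem_filter.1 hp).2]

lemma aux_monoU {ι : Type*} (P : Finset ι) (a : ι → ℝ) (e : ι → ℕ) (n : ι → ℕ) :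
    ∏ p ∈ P, (monomial (e p) (a p)) ^ n p = monomial (∑ p ∈ P, e p * n p) (∏ p ∈ P, a p ^ n p) := by
  induction P using Finset.induction_on with
  | empty => simp
  | insert x s hx ih => 
    rw [Finset.prod_insert hx, ih, monomial_pow, monomial_mul_monomial, Finset.sum_insert hx, Finset.prod_insert hx]

lemma aux_monoB {ι : Type*} (P : Finset ι) (a : ι → ℝ) (e f : ι → ℕ) (n : ι → ℕ) :
    ∏ p ∈ P, (monomial (e p) (monomial (f p) (a p)) : ℝ[X][X]) ^ n p
      = monomial (∑ p ∈ P, e p * n p) (monomial (∑ p ∈ P, f p * n p) (∏ p ∈ P, a p ^ n p)) := by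
  induction P using Finset.induction_on with
  | empty => simp
  | insert x s hx ih => 
    rw [Finset.prod_insert hx, ih, monomial_pow, monomial_mul_monomial, monomial_pow, monomial_mul_monomial,
      Finset.sum_insert hx, Finset.prod_insert hx, Finset.sum_insert hx]

lemma aux_choose_up (E v : ℕ) (hv : v ≤ E) : Real.log ((E.choose v : ℕ):ℝ) ≤ v * Real.log E - v * Real.log v + v := by
  have h := Nat.choose_le_pow_div (α := ℝ) v E
  rcases Nat.eq_zero_or_pos v with h0 | h0
  · subst h0; simp
  have hE : 0 < E := by omega
  have hE' : (0:ℝ) < E := by exact_mod_cast hE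
  have hc : (0:ℝ) < (E.choose v : ℝ) := by exact_mod_cast Nat.choose_pos hv
  have := Real.log_le_log hc h
  rw [Real.log_div (by positivity) (by positivity), Real.log_pow] at this
  have h2 := aux_log_fact_lower v
  linarith

/-- rounding -/
lemma aux_round {ι : Type*} (s : Finset ι) (i : ι → ℕ) (hi : ∀ p ∈ s, 0 < i p) (p0 : ι) (hp0 : p0 ∈ s) (r : ℕ) (hr : 0 < r)
    (z : ι → ℝ) (hz : ∀ p ∈ s, 0 ≤ z p) (w0 : ℕ) (hw : ∑ p ∈ s, (i p:ℝ) * z p = w0) :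
    ∃ N : ℕ → ι → ℕ, (∀ k, ∑ p ∈ s, i p * N k p = k * (r * i p0) * w0) ∧ (∀ k, ∀ p ∈ s, r ∣ N k p) ∧
      ∀ p ∈ s, Tendsto (fun k : ℕ => (N k p : ℝ) / k) atTop (nhds ((r * i p0 : ℕ) * z p)) := by
  have hi0 := hi p0 hp0
  set f : ℕ → ι → ℕ := fun k p => ⌊z p * (k:ℝ)⌋₊ with hf
  have hfle : ∀ k, ∀ p ∈ s, (f k p : ℝ) ≤ z p * k := fun k p hp => Nat.floor_le (mul_nonneg (hz p hp) (Nat.cast_nonneg _))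
  have hft : ∀ p ∈ s, Tendsto (fun k : ℕ => (f k p : ℝ) / k) atTop (nhds (z p)) := fun p hp =>
    (tendsto_nat_floor_mul_div_atTop (R := ℝ) (hz p hp)).comp tendsto_natCast_atTop_atTop
  set g : ℕ → ℕ := fun k => ∑ p ∈ s.erase p0, i p * f k p with hg
  have hw' : (i p0:ℝ) * z p0 + ∑ p ∈ s.erase p0, (i p:ℝ) * z p = w0 := by rw [← hw, ← Finset.add_sum_erase s (fun p => (i p:ℝ) * z p) hp0]
  have hgle : ∀ k, g k ≤ k * w0 := by
    intro k
    have : (g k:ℝ) ≤ k * w0 := by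
      rw [hg, ← hw']; push_cast
      calc ∑ p ∈ s.erase p0, (i p:ℝ) * (f k p:ℝ) ≤ ∑ p ∈ s.erase p0, (i p:ℝ) * (z p * k) :=
            Finset.sum_le_sum fun p hp => mul_le_mul_of_nonneg_left (hfle k p (Finset.mem_of_mem_erase hp)) (Nat.cast_nonneg _)
        _ = k * ∑ p ∈ s.erase p0, (i p:ℝ) * z p := by rw [Finset.mul_sum]; exact Finset.sum_congr rfl fun p _ => by ring
        _ ≤ _ := by
          have := hz p0 hp0
          gcongr
          have : 0 ≤ (i p0:ℝ) * z p0 := by positivity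
          linarith
    exact_mod_cast this
  have hgt : Tendsto (fun k : ℕ => (g k : ℝ) / k) atTop (nhds (∑ p ∈ s.erase p0, (i p:ℝ) * z p)) := by
    have : (fun k : ℕ => (g k : ℝ) / k) = fun k : ℕ => ∑ p ∈ s.erase p0, (i p:ℝ) * ((f k p:ℝ)/k) := by
      ext k; rw [hg]; push_cast; rw [Finset.sum_div]; exact Finset.sum_congr rfl fun p _ => by ring
    rw [this]
    exact tendsto_finsetSum _ fun p hp => (hft p (Finset.mem_of_mem_erase hp)).const_mul _
  refine ⟨fun k p => if p = p0 then r * (k * w0 - g k) else r * i p0 * f k p, fun k => ?_, fun k p hp => ?_, fun p hp => ?_⟩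
  · dsimp only
    rw [← Finset.add_sum_erase _ _ hp0, if_pos rfl]
    have : ∑ p ∈ s.erase p0, i p * (if p = p0 then r * (k * w0 - g k) else r * i p0 * f k p) = r * i p0 * g k := by
      rw [hg, Finset.mul_sum]
      exact Finset.sum_congr rfl fun p hp => by rw [if_neg (Finset.ne_of_mem_erase hp)]; ring
    rw [this]
    obtain ⟨d, hd⟩ := Nat.exists_eq_add_of_le (hgle k)
    have e : k * w0 - g k = d := by omega
    rw [e]
    calc _ = r * i p0 * (g k + d) := by ring
      _ = _ := by rw [← hd]; ring
  · dsimp only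
    split_ifs
    · exact Dvd.intro _ rfl
    · exact ⟨i p0 * f k p, by ring⟩
  · dsimp only
    split_ifs with h
    · subst h
      have h1 : Tendsto (fun k : ℕ => (r:ℝ) * ((w0:ℝ) - (g k:ℝ)/k)) atTop (nhds (r * ((w0:ℝ) - ∑ p ∈ s.erase p, (i p:ℝ) * z p))) :=
        (tendsto_const_nhds.sub hgt).const_mul _
      have e : (r:ℝ) * ((w0:ℝ) - ∑ p ∈ s.erase p, (i p:ℝ) * z p) = (r * i p : ℕ) * z p := by
        rw [← hw']; push_cast; ring
      rw [e] at h1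
      refine h1.congr' ?_
      filter_upwards [eventually_gt_atTop 0] with k hk
      have hk' : (k:ℝ) ≠ 0 := by positivity
      push_cast [Nat.cast_sub (hgle k)]
      field_simp
    · have := (hft p hp).const_mul ((r * i p0 : ℕ):ℝ)
      refine this.congr fun k => ?_
      push_cast; ring

namespace DGLDPC
variable (M : DGLDPC)

noncomputable def auxXc : Finset (Fin M.nc) := Finset.univ.filter (fun t => M.rd t = M.r)

lemma aux_Bcone (t : Fin M.nv) : M.Bpoly t - (1 + ∑ p ∈ M.auxP with p.1 = t,
    (monomial p.2.1 (monomial p.2.2 (M.B p.1 p.2.1 p.2.2 : ℝ)) : ℝ[X][X])) ∈ auxConeB := by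
  intro u v
  have hB : ((M.Bpoly t).coeff u).coeff v = M.B t u v := by
    unfold Bpoly
    rw [finsetSum_coeff, finsetSum_coeff]
    simp only [coeff_C_mul_X_pow]
    by_cases hu : u ∈ range (M.kdim t + 1)
    · rw [Finset.sum_eq_single u (fun b _ hb => by rw [if_neg (Ne.symm hb), coeff_zero]) (fun h => (h hu).elim),
        if_pos rfl, finsetSum_coeff]
      simp only [coeff_C_mul_X_pow]
      by_cases hv : v ∈ range (M.q t + 1)
      · rw [Finset.sum_eq_single v (fun b _ hb => by rw [if_neg (Ne.symm hb)]) (fun h => (h hv).elim), if_pos rfl]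
      · rw [Finset.sum_eq_zero (fun b hb => by rw [if_neg]; rintro rfl; exact hv hb)]
        rw [Finset.mem_range] at hv
        rw [M.hBsupp t u v (by omega) (by omega)]; simp
    · rw [Finset.sum_eq_zero (fun b hb => by rw [if_neg, coeff_zero]; rintro rfl; exact hu hb)]
      rw [Finset.mem_range] at hu
      rw [M.hBsupp t u v (by omega) (by omega)]; simp
  have hS : ((∑ p ∈ M.auxP with p.1 = t,
    (monomial p.2.1 (monomial p.2.2 (M.B p.1 p.2.1 p.2.2 : ℝ)) : ℝ[X][X])).coeff u).coeff v =
      if (t,u,v) ∈ M.auxP then (M.B t u v : ℝ) else 0 := by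
    rw [finsetSum_coeff, finsetSum_coeff]
    have hz : ∀ p ∈ M.auxP.filter (fun p => p.1 = t), p ≠ (t,u,v) → 
       ((monomial p.2.1 (monomial p.2.2 (M.B p.1 p.2.1 p.2.2 : ℝ)) : ℝ[X][X]).coeff u).coeff v = 0 := by
      intro p hp hne
      rw [coeff_monomial]
      split_ifs with h1
      · rw [coeff_monomial, if_neg]
        intro h2
        exact hne (Prod.ext (Finset.mem_filter.1 hp).2 (Prod.ext h1 h2))
      · simp
    split_ifs with h
    · rw [Finset.sum_eq_single (t,u,v) hz (fun h' => (h' (Finset.mem_filter.2 ⟨h, rfl⟩)).elim)]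
      simp
    · refine Finset.sum_eq_zero fun p hp => hz p hp ?_
      rintro rfl
      exact h (Finset.mem_filter.1 hp).1
  rw [coeff_sub, coeff_sub, coeff_add, coeff_add, hB, hS, coeff_one]
  by_cases h0 : u = 0 ∧ v = 0
  · obtain ⟨rfl, rfl⟩ := h0
    have hn : (t, 0, 0) ∉ M.auxP := fun h => by
      have := (M.aux_S_bd (M.aux_P_S h)).1
      simp at this
    rw [if_neg hn, M.hB00]
    simp
  · have h1 : (if u = 0 then (1:ℝ[X]) else 0).coeff v = 0 := by
      split_ifs with h
      · rw [coeff_one, if_neg (fun h' => h0 ⟨h, h'⟩)]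
      · simp
    rw [h1]
    split_ifs <;> simp

lemma aux_Acone (t : Fin M.nc) : M.Apoly t - (1 + ∑ p ∈ M.auxXc with p = t,
    (monomial M.r (M.A p M.r : ℝ) : ℝ[X])) ∈ auxConeU := by
  intro u
  have hr := M.aux_r2
  have hB : (M.Apoly t).coeff u = M.A t u := by
    unfold Apoly
    rw [finsetSum_coeff]
    simp only [coeff_C_mul_X_pow]
    by_cases hu : u ∈ range (M.s t + 1)
    · rw [Finset.sum_eq_single u (fun b _ hb => by rw [if_neg (Ne.symm hb)]) (fun h => (h hu).elim), if_pos rfl]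
    · rw [Finset.sum_eq_zero (fun b hb => by rw [if_neg]; rintro rfl; exact hu hb)]
      rw [Finset.mem_range] at hu
      rw [M.hAsupp t u (by omega) (by omega)]; simp
  have hS : (∑ p ∈ M.auxXc with p = t, (monomial M.r (M.A p M.r : ℝ) : ℝ[X])).coeff u =
      if t ∈ M.auxXc ∧ M.r = u then (M.A t u : ℝ) else 0 := by
    rw [Finset.filter_eq']
    by_cases h : t ∈ M.auxXc
    · rw [if_pos h, Finset.sum_singleton, coeff_monomial]
      by_cases h2 : M.r = u
      · rw [if_pos h2, if_pos ⟨h, h2⟩, h2]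
      · rw [if_neg h2, if_neg (fun h' => h2 h'.2)]
    · rw [if_neg h, if_neg (fun h' => h h'.1)]; simp
  rw [coeff_sub, coeff_add, hB, hS, coeff_one]
  by_cases h0 : u = 0
  · subst h0
    have hn : ¬ (t ∈ M.auxXc ∧ M.r = 0) := fun h => by omega
    rw [if_neg hn, M.hA0]; simp
  · rw [if_neg h0]
    split_ifs <;> simp

end DGLDPC


namespace DGLDPC
variable (M : DGLDPC)

lemma aux_Xc_sum (f : Fin M.nc → ℝ) {t : Fin M.nc} (h : t ∈ M.auxXc) : ∑ p ∈ M.auxXc with p = t, f p = f t := by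
  rw [Finset.filter_eq', if_pos h, Finset.sum_singleton]

lemma aux_Xc_A {t : Fin M.nc} (h : t ∈ M.auxXc) : 0 < M.A t M.r := by
  have := (Finset.mem_filter.1 h).2
  rw [← this]; exact M.hAr t

lemma aux_P_B {p : Fin M.nv × ℕ × ℕ} (h : p ∈ M.auxP) : 0 < M.B p.1 p.2.1 p.2.2 :=
  ((M.aux_mem_S p).1 (M.aux_P_S h)).1

noncomputable def auxPhi (Y : Fin M.nv × ℕ × ℕ → ℝ) (U : Fin M.nc → ℝ) : ℝ :=
  ∑ p ∈ M.auxP, Y p * (Real.log (M.lam p.1 / M.q p.1 - ∑ p' ∈ M.auxP with p'.1 = p.1, Y p') - Real.log (Y p) + 1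
      + Real.log (M.B p.1 p.2.1 p.2.2))
  + ∑ t ∈ M.auxXc, U t * (Real.log (M.ρ t / M.s t - U t) - Real.log (U t) + 1 + Real.log (M.A t M.r))
  + ((∑ p ∈ M.auxP, (p.2.2:ℝ) * Y p) * Real.log (∑ p ∈ M.auxP, (p.2.2:ℝ) * Y p) - ∑ p ∈ M.auxP, (p.2.2:ℝ) * Y p)

set_option maxHeartbeats 1600000 in
lemma aux_int_lower {n : ℕ} (hI : M.auxInt n) (hn : 0 < n) (a : Fin M.nv × ℕ × ℕ → ℕ) (m : Fin M.nc → ℕ) (w v : ℕ)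
    (hw : ∑ p ∈ M.auxP, p.2.1 * a p = w) (hv : ∑ p ∈ M.auxP, p.2.2 * a p = v) (hm : M.r * ∑ t ∈ M.auxXc, m t = v)
    (hvE : v ≤ M.En n) (hN : ∀ t, ∑ p ∈ M.auxP with p.1 = t, a p < M.vExp n t)
    (hM : ∀ t, ∑ p ∈ M.auxXc with p = t, m p < M.cExp n t) :
    0 < M.ENw n w ∧ (M.En n:ℝ) * M.auxPhi (fun p => a p / M.En n) (fun t => m t / M.En n)
      - (M.auxP.card + M.auxXc.card : ℝ) * (1 + Real.log ((M.En n:ℝ) + 1)) ≤ Real.log (M.ENw n w) := by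
  have hnR : (0:ℝ) < n := by exact_mod_cast hn
  have hil := M.aux_intlam_pos
  have hEn := M.aux_En_eq hI
  have hE : (0:ℝ) < M.En n := by
    by_contra h; push Not at h; nlinarith
  have hr := M.aux_r2
  obtain ⟨c, hc0, hcS, hcl⟩ := aux_cfg auxConeB M.auxP (fun p => p.1) M.Bpoly
    (fun p => (monomial p.2.1 (monomial p.2.2 (M.B p.1 p.2.1 p.2.2 : ℝ)) : ℝ[X][X]))
    (by
      intro p _ u v
      rw [coeff_monomial]
      split_ifs
      · rw [coeff_monomial]; split_ifs
        · positivity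
        · exact le_rfl
      · simp) M.aux_Bcone a (M.vExp n) hN
  obtain ⟨d, hd0, hdS, hdl⟩ := aux_cfg auxConeU M.auxXc (fun t => t) M.Apoly
    (fun p => (monomial M.r (M.A p M.r : ℝ) : ℝ[X]))
    (by
      intro p _ u
      rw [coeff_monomial]
      split_ifs
      · positivity
      · exact le_rfl) M.aux_Acone m (M.cExp n) hM
  rw [aux_monoB M.auxP (fun p => (M.B p.1 p.2.1 p.2.2 : ℝ)) (fun p => p.2.1) (fun p => p.2.2) a, hw, hv] at hcS
  rw [aux_monoU M.auxXc (fun p => (M.A p M.r : ℝ)) (fun _ => M.r) m, ← Finset.mul_sum, hm] at hdS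
  have hB : ∀ p ∈ M.auxP, (M.B p.1 p.2.1 p.2.2 : ℝ) ^ a p ≠ 0 := fun p hp => by
    have := M.aux_P_B hp
    positivity
  have hA : ∀ p ∈ M.auxXc, (M.A p M.r : ℝ) ^ m p ≠ 0 := fun p hp => by
    have := M.aux_Xc_A hp
    positivity
  have hB' : 0 < ∏ p ∈ M.auxP, (M.B p.1 p.2.1 p.2.2 : ℝ) ^ a p := Finset.prod_pos fun p hp => by
    have := M.aux_P_B hp
    positivity
  have hA' : 0 < ∏ p ∈ M.auxXc, (M.A p M.r : ℝ) ^ m p := Finset.prod_pos fun p hp => by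
    have := M.aux_Xc_A hp
    positivity
  have hc0' : (0:ℝ) < c := by exact_mod_cast hc0
  have hd0' : (0:ℝ) < d := by exact_mod_cast hd0
  have h1 : (c:ℝ) * ∏ p ∈ M.auxP, (M.B p.1 p.2.1 p.2.2 : ℝ) ^ a p ≤ M.NvCount n w v := by
    have := hcS w v
    have e : (c : ℝ[X][X]) = C (C (c:ℝ)) := by simp
    rw [coeff_sub, coeff_sub, e, coeff_C_mul, coeff_monomial, if_pos rfl, coeff_C_mul, coeff_monomial, if_pos rfl] at this
    unfold NvCount
    linarith
  have h2 : (d:ℝ) * ∏ p ∈ M.auxXc, (M.A p M.r : ℝ) ^ m p ≤ M.NcCount n v := by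
    have := hdS v
    have e : (d : ℝ[X]) = C (d:ℝ) := by simp
    rw [coeff_sub, e, coeff_C_mul, coeff_monomial, if_pos rfl] at this
    unfold NcCount
    linarith
  obtain ⟨h3, h4⟩ := M.aux_term_log_le n w v hvE _ _ (by positivity) (by positivity) h1 h2
  refine ⟨h3, le_trans ?_ h4⟩
  have h5 := aux_choose_up (M.En n) v hvE
  rw [Real.log_mul hc0'.ne' hB'.ne', Real.log_mul hd0'.ne' hA'.ne', Real.log_prod hB, Real.log_prod hA]
  set E : ℝ := (M.En n : ℝ) with hEd
  -- sizes
  have hble : ∀ b : ℕ, b ≤ v → 1 + Real.log ((b:ℝ) + 1) ≤ 1 + Real.log (E+1) := fun b hb => by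
    have : (b:ℝ) ≤ E := by rw [hEd]; exact_mod_cast hb.trans hvE
    have := Real.log_le_log (by positivity) (by linarith : (b:ℝ)+1 ≤ E+1)
    linarith
  have hav : ∀ p ∈ M.auxP, a p ≤ v := fun p hp => by
    have h1 := Finset.single_le_sum (f := fun p : Fin M.nv × ℕ × ℕ => p.2.2 * a p) (fun _ _ => Nat.zero_le _) hp
    rw [hv] at h1
    have h2 := (M.aux_S_bd (M.aux_P_S hp)).2.2.1
    nlinarith
  have hmv : ∀ p ∈ M.auxXc, m p ≤ v := fun p hp => by
    have h1 := Finset.single_le_sum (f := fun p => m p) (fun _ _ => Nat.zero_le _) hp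
    nlinarith
  -- VN sum
  have e1 : E * ∑ p ∈ M.auxP, (a p / E) * (Real.log (M.lam p.1 / M.q p.1 - ∑ p' ∈ M.auxP with p'.1 = p.1, (a p' / E)) - Real.log (a p / E) + 1
      + Real.log (M.B p.1 p.2.1 p.2.2)) - M.auxP.card * (1 + Real.log (E+1)) ≤ Real.log c + ∑ i ∈ M.auxP, Real.log ((M.B i.1 i.2.1 i.2.2:ℝ) ^ a i) := by
    refine le_trans ?_ (add_le_add_left hcl _)
    rw [← Finset.sum_add_distrib, Finset.mul_sum, ← nsmul_eq_mul, ← Finset.sum_const, ← Finset.sum_sub_distrib]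
    refine Finset.sum_le_sum fun p hp => ?_
    have hb := hble _ (hav p hp)
    have hx : (M.vExp n p.1 : ℝ) - ∑ p' ∈ M.auxP with p'.1 = p.1, (a p':ℝ) 
       = E * (M.lam p.1 / M.q p.1 - ∑ p' ∈ M.auxP with p'.1 = p.1, (a p' / E)) := by
      rw [hI.2.2, ← Finset.sum_div, ← hEd]; field_simp
    have hpos : 0 < (M.vExp n p.1 : ℝ) - ∑ p' ∈ M.auxP with p'.1 = p.1, (a p':ℝ) := by
      rw [sub_pos]; exact_mod_cast hN p.1
    rw [hx] at hpos
    have hpos' := pos_of_mul_pos_right hpos hE.le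
    rw [hx, Real.log_mul hE.ne' hpos'.ne', Real.log_pow]
    rcases Nat.eq_zero_or_pos (a p) with h0 | h0
    · rw [h0] at hb ⊢
      simp only [Nat.cast_zero, zero_div, zero_mul, mul_zero] at hb ⊢
      linarith
    · have h0' : (0:ℝ) < a p := by exact_mod_cast h0
      rw [Real.log_div h0'.ne' hE.ne', ← mul_assoc, mul_div_cancel₀ _ hE.ne']
      linarith
  have e2 : E * ∑ t ∈ M.auxXc, (m t / E) * (Real.log (M.ρ t / M.s t - m t / E) - Real.log (m t / E) + 1
      + Real.log (M.A t M.r)) - M.auxXc.card * (1 + Real.log (E+1)) ≤ Real.log d + ∑ i ∈ M.auxXc, Real.log ((M.A i M.r:ℝ) ^ m i) := by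
    refine le_trans ?_ (add_le_add_left hdl _)
    rw [← Finset.sum_add_distrib, Finset.mul_sum, ← nsmul_eq_mul, ← Finset.sum_const, ← Finset.sum_sub_distrib]
    refine Finset.sum_le_sum fun t ht => ?_
    have hb := hble _ (hmv t ht)
    have hpos : 0 < (M.cExp n t : ℝ) - ∑ p' ∈ M.auxXc with p' = t, (m p':ℝ) := by
      rw [sub_pos]; exact_mod_cast hM t
    rw [M.aux_Xc_sum (fun p => (m p:ℝ)) ht] at hpos ⊢
    have hx : (M.cExp n t : ℝ) - m t = E * (M.ρ t / M.s t - m t / E) := by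
      rw [hI.2.1, ← hEd]; field_simp
    rw [hx] at hpos
    have hpos' := pos_of_mul_pos_right hpos hE.le
    rw [hx, Real.log_mul hE.ne' hpos'.ne', Real.log_pow]
    rcases Nat.eq_zero_or_pos (m t) with h0 | h0
    · rw [h0] at hb ⊢
      simp only [Nat.cast_zero, zero_div, zero_mul, mul_zero] at hb ⊢
      linarith
    · have h0' : (0:ℝ) < m t := by exact_mod_cast h0
      rw [Real.log_div h0'.ne' hE.ne', ← mul_assoc, mul_div_cancel₀ _ hE.ne']
      linarith
  have e3 : ∑ p ∈ M.auxP, (p.2.2:ℝ) * (a p / E) = v / E := by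
    rw [← hv]; push_cast; rw [Finset.sum_div]; exact Finset.sum_congr rfl fun p _ => by ring
  have e4 : E * ((v/E) * Real.log (v/E) - v/E) ≤ - Real.log ((M.En n).choose v : ℝ) := by
    rcases Nat.eq_zero_or_pos v with h0 | h0
    · rw [h0]; simp
    · have h0' : (0:ℝ) < v := by exact_mod_cast h0
      rw [Real.log_div h0'.ne' hE.ne']
      have : E * ((v/E) * (Real.log v - Real.log E) - v/E) = v * (Real.log v - Real.log E) - v := by field_simp
      rw [this]; linarith
  unfold auxPhi
  dsimp only
  rw [e3, mul_add, mul_add]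
  linarith

end DGLDPC


namespace DGLDPC
variable (M : DGLDPC)

lemma aux_Phi_tendsto {Y : Fin M.nv × ℕ × ℕ → ℝ} {U : Fin M.nc → ℝ} {Yk : ℕ → Fin M.nv × ℕ × ℕ → ℝ} {Uk : ℕ → Fin M.nc → ℝ}
    (hY : ∀ p ∈ M.auxP, 0 < Y p) (hU : ∀ t ∈ M.auxXc, 0 < U t)
    (hσ : ∀ t, ∑ p ∈ M.auxP with p.1 = t, Y p < M.lam t / M.q t)
    (hμ : ∀ t ∈ M.auxXc, U t < M.ρ t / M.s t)
    (hYk : ∀ p ∈ M.auxP, Tendsto (fun k => Yk k p) atTop (nhds (Y p)))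
    (hUk : ∀ t ∈ M.auxXc, Tendsto (fun k => Uk k t) atTop (nhds (U t))) :
    Tendsto (fun k => M.auxPhi (Yk k) (Uk k)) atTop (nhds (M.auxPhi Y U)) := by
  have hβ : Tendsto (fun k => ∑ p ∈ M.auxP, (p.2.2:ℝ) * Yk k p) atTop (nhds (∑ p ∈ M.auxP, (p.2.2:ℝ) * Y p)) :=
    tendsto_finsetSum _ fun p hp => (hYk p hp).const_mul _
  have hβ0 : 0 < ∑ p ∈ M.auxP, (p.2.2:ℝ) * Y p := Finset.sum_pos (fun p hp => by
    have h2 := (M.aux_S_bd (M.aux_P_S hp)).2.2.1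
    have h3 : (0:ℝ) < p.2.2 := by exact_mod_cast (by omega : 0 < p.2.2)
    exact mul_pos h3 (hY p hp)) M.aux_P_nonempty
  unfold auxPhi
  refine ((tendsto_finsetSum _ fun p hp => ?_).add (tendsto_finsetSum _ fun t ht => ?_)).add
    ((hβ.mul (hβ.log hβ0.ne')).sub hβ)
  · have hs : Tendsto (fun k => ∑ p' ∈ M.auxP with p'.1 = p.1, Yk k p') atTop (nhds (∑ p' ∈ M.auxP with p'.1 = p.1, Y p')) :=
      tendsto_finsetSum _ fun p' hp' => hYk p' (Finset.mem_filter.1 hp').1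
    exact (hYk p hp).mul (((((tendsto_const_nhds.sub hs).log (sub_pos.2 (hσ p.1)).ne').sub
      ((hYk p hp).log (hY p hp).ne')).add tendsto_const_nhds).add tendsto_const_nhds)
  · exact (hUk t ht).mul (((((tendsto_const_nhds.sub (hUk t ht)).log (sub_pos.2 (hμ t ht)).ne').sub
      ((hUk t ht).log (hU t ht).ne')).add tendsto_const_nhds).add tendsto_const_nhds)

lemma aux_lower_lim {α : ℝ} (hα : 0 < α) {n0 : ℕ} (h0 : M.Adm α n0) {Y : Fin M.nv × ℕ × ℕ → ℝ} {U : Fin M.nc → ℝ}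
    (hY : ∀ p ∈ M.auxP, 0 < Y p) (hU : ∀ t ∈ M.auxXc, 0 < U t)
    (hσ : ∀ t, ∑ p ∈ M.auxP with p.1 = t, Y p < M.lam t / M.q t)
    (hμ : ∀ t ∈ M.auxXc, U t < M.ρ t / M.s t)
    (hYi : ∑ p ∈ M.auxP, (p.2.1:ℝ) * Y p = α * M.intlam)
    (hUY : M.r * ∑ t ∈ M.auxXc, U t = ∑ p ∈ M.auxP, (p.2.2:ℝ) * Y p)
    (hβ1 : ∑ p ∈ M.auxP, (p.2.2:ℝ) * Y p < 1) {G : ℝ}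
    (hG : ∀ n, M.Adm α n → Real.log (M.ENw n ⌊α * (n : ℝ)⌋₊) - (2 + 3 * Real.log ((M.En n:ℝ)+1)) ≤ G * n) :
    M.auxPhi Y U ≤ G * M.intlam := by
  rw [aux_Adm_iff] at h0
  obtain ⟨hn0, hI0, hw0, -⟩ := h0
  have hil := M.aux_intlam_pos
  have hr2 := M.aux_r2
  have hrR := M.aux_r2R
  have hE0 := M.aux_En_eq hI0
  have hn0R : (0:ℝ) < n0 := by exact_mod_cast hn0
  have hE0p : (0:ℝ) < M.En n0 := by
    by_contra h; push Not at h; nlinarith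
  set w0 := ⌊α * (n0 : ℝ)⌋₊ with hw0d
  obtain ⟨p0, hp0⟩ := M.aux_P_nonempty
  obtain ⟨t0, ht0'⟩ := M.aux_r_att
  have ht0 : t0 ∈ M.auxXc := Finset.mem_filter.2 ⟨Finset.mem_univ _, ht0'⟩
  have hipos : ∀ p ∈ M.auxP, 0 < p.2.1 := fun p hp => (M.aux_S_bd (M.aux_P_S hp)).1
  obtain ⟨N, hN1, hN2, hN3⟩ := aux_round M.auxP (fun p => p.2.1) hipos p0 hp0 M.r (by omega)
    (fun p => M.En n0 * Y p) (fun p hp => mul_nonneg hE0p.le (hY p hp).le) w0 (by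
      rw [hw0, ← hE0]
      calc _ = (M.En n0:ℝ) * ∑ p ∈ M.auxP, (p.2.1:ℝ) * Y p := by
            rw [Finset.mul_sum]; exact Finset.sum_congr rfl fun p _ => by ring
        _ = _ := by rw [hYi]; ring)
  set β := ∑ p ∈ M.auxP, (p.2.2:ℝ) * Y p with hβ
  have hβ0 : 0 < β := Finset.sum_pos (fun p hp => by
    have h2 := (M.aux_S_bd (M.aux_P_S hp)).2.2.1
    have h3 : (0:ℝ) < p.2.2 := by exact_mod_cast (by omega : 0 < p.2.2)
    exact mul_pos h3 (hY p hp)) M.aux_P_nonempty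
  have hr0 : (0:ℝ) < M.r := by linarith
  obtain ⟨m, hm1, -, hm3⟩ := aux_round M.auxXc (fun _ => 1) (fun _ _ => one_pos) t0 ht0 1 one_pos
    (fun t => M.r * U t / β) (fun t ht => div_nonneg (mul_nonneg hr0.le (hU t ht).le) hβ0.le) 1 (by
      simp only [Nat.cast_one, one_mul]
      rw [← Finset.sum_div, ← Finset.mul_sum, hUY, div_self hβ0.ne'])
  simp only [one_mul, mul_one, Nat.cast_one] at hm1 hm3
  set L := M.r * p0.2.1 with hL
  have hLpos : 0 < L := Nat.mul_pos (by omega) (hipos p0 hp0)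
  have hLR : (0:ℝ) < L := by exact_mod_cast hLpos
  set n : ℕ → ℕ := fun k => k * L * n0 with hn
  have hIn : ∀ k, M.auxInt (n k) := fun k => (M.aux_int_mul hI0 (k*L)).1
  have hEn : ∀ k, (M.En (n k):ℝ) = k * L * M.En n0 := fun k => by
    rw [hn]; dsimp only; rw [(M.aux_int_mul hI0 (k*L)).2]; push_cast; ring
  have hEtop : Tendsto (fun k => (M.En (n k):ℝ)) atTop atTop := by
    simp only [hEn, mul_assoc]
    exact tendsto_natCast_atTop_atTop.atTop_mul_const (mul_pos hLR hE0p)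
  have hYk : ∀ p ∈ M.auxP, Tendsto (fun k => (N k p:ℝ) / M.En (n k)) atTop (nhds (Y p)) := by
    intro p hp
    have h1 := (hN3 p hp).div_const ((L:ℝ) * M.En n0)
    have e : (L:ℝ) * (M.En n0 * Y p) / ((L:ℝ) * M.En n0) = Y p := by field_simp
    rw [e] at h1
    refine h1.congr fun k => ?_
    rw [hEn, div_div, mul_assoc]
  choose! N' hN' using hN2
  set V : ℕ → ℕ := fun k => ∑ p ∈ M.auxP, p.2.2 * N' k p with hV
  have hVr : ∀ k, ∑ p ∈ M.auxP, p.2.2 * N k p = M.r * V k := fun k => by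
    rw [hV, Finset.mul_sum]; exact Finset.sum_congr rfl fun p hp => by
      conv_lhs => rw [hN' k p hp]
      ring
  have hvt : Tendsto (fun k => ((M.r * V k : ℕ):ℝ) / M.En (n k)) atTop (nhds β) := by
    have h1 : Tendsto (fun k => ∑ p ∈ M.auxP, (p.2.2:ℝ) * ((N k p:ℝ) / M.En (n k))) atTop (nhds β) :=
      tendsto_finsetSum _ fun p hp => (hYk p hp).const_mul _
    refine h1.congr fun k => ?_
    rw [← hVr]; push_cast; rw [Finset.sum_div]; exact Finset.sum_congr rfl fun p _ => by ring
  have hVt : Tendsto (fun k => (V k:ℝ) / M.En (n k)) atTop (nhds (β / M.r)) := by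
    refine (hvt.div_const (M.r:ℝ)).congr fun k => ?_
    push_cast; field_simp
  have hVtop : Tendsto V atTop atTop := by
    rw [← tendsto_natCast_atTop_iff (R := ℝ)]
    have h1 := hVt.pos_mul_atTop (div_pos hβ0 hr0) hEtop
    refine h1.congr' ?_
    filter_upwards [hEtop.eventually_gt_atTop 0] with k hk
    field_simp
  have hUk : ∀ t ∈ M.auxXc, Tendsto (fun k => (m (V k) t:ℝ) / M.En (n k)) atTop (nhds (U t)) := by
    intro t ht
    have h1 := ((hm3 t ht).comp hVtop).mul hVt
    have e : M.r * U t / β * (β / M.r) = U t := by field_simp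
    rw [e] at h1
    refine h1.congr' ?_
    filter_upwards [hVtop.eventually_gt_atTop 0] with k hk
    have : (V k:ℝ) ≠ 0 := by positivity
    simp only [Function.comp]
    field_simp
  have hPhi := M.aux_Phi_tendsto hY hU hσ hμ hYk hUk
  set c : ℝ := (M.auxP.card + M.auxXc.card : ℝ) with hc
  have hlog : Tendsto (fun x : ℝ => Real.log (x+1) / x) atTop (nhds 0) := by
    have h1 : Tendsto (fun x : ℝ => Real.log (x+1) / (1 * (x + 1) + (-1))) atTop (nhds 0) := by
      have := Real.tendsto_pow_log_div_mul_add_atTop 1 (-1) 1 one_ne_zero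
      have h2 := this.comp (tendsto_atTop_add_const_right atTop (1:ℝ) tendsto_id)
      refine h2.congr fun x => ?_
      simp
    refine h1.congr fun x => ?_
    congr 1; ring
  have herr : Tendsto (fun k => ((c + 2) + (c + 3) * Real.log ((M.En (n k):ℝ)+1)) / M.En (n k)) atTop (nhds 0) := by
    have h1 := (hEtop.const_div_atTop (c+2)).add ((hlog.comp hEtop).const_mul (c+3))
    rw [mul_zero, add_zero] at h1
    refine h1.congr fun k => ?_
    simp only [Function.comp]
    ring
  have hfin : ∀ᶠ k in atTop, M.auxPhi (fun p => (N k p:ℝ) / M.En (n k)) (fun t => (m (V k) t:ℝ) / M.En (n k)) 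
      - ((c + 2) + (c + 3) * Real.log ((M.En (n k):ℝ)+1)) / M.En (n k) ≤ G * M.intlam := by
    have hNk : ∀ t, ∀ᶠ k in atTop, ∑ p ∈ M.auxP with p.1 = t, N k p < M.vExp (n k) t := by
      intro t
      have h1 : Tendsto (fun k => ∑ p ∈ M.auxP with p.1 = t, (N k p:ℝ) / M.En (n k)) atTop (nhds (∑ p ∈ M.auxP with p.1 = t, Y p)) :=
        tendsto_finsetSum _ fun p hp => hYk p (Finset.mem_filter.1 hp).1
      filter_upwards [h1.eventually_lt_const (hσ t), hEtop.eventually_gt_atTop 0] with k hk hkE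
      rw [← Finset.sum_div, div_lt_iff₀ hkE] at hk
      have : (∑ p ∈ M.auxP with p.1 = t, (N k p:ℝ)) < M.vExp (n k) t := by
        rw [(hIn k).2.2]; refine hk.trans_eq ?_; ring
      exact_mod_cast this
    have hMk : ∀ t, ∀ᶠ k in atTop, ∑ p ∈ M.auxXc with p = t, m (V k) p < M.cExp (n k) t := by
      intro t
      by_cases ht : t ∈ M.auxXc
      · filter_upwards [(hUk t ht).eventually_lt_const (hμ t ht), hEtop.eventually_gt_atTop 0] with k hk hkE
        rw [div_lt_iff₀ hkE] at hk
        have : (∑ p ∈ M.auxXc with p = t, (m (V k) p:ℝ)) < M.cExp (n k) t := by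
          rw [(hIn k).2.1, M.aux_Xc_sum (fun p => (m (V k) p:ℝ)) ht]; refine hk.trans_eq ?_; ring
        exact_mod_cast this
      · filter_upwards [hEtop.eventually_gt_atTop 0] with k hkE
        rw [Finset.filter_eq', if_neg ht, Finset.sum_empty]
        have : (0:ℝ) < M.cExp (n k) t := by
          rw [(hIn k).2.1, mul_div_assoc]; exact mul_pos hkE (M.aux_rs_pos t)
        exact_mod_cast this
    filter_upwards [eventually_all.2 hNk, eventually_all.2 hMk, hvt.eventually_lt_const hβ1,
      hEtop.eventually_gt_atTop 0, eventually_gt_atTop 0] with k h1 h2 h3 hkE hk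
    have hnk : 0 < n k := Nat.mul_pos (Nat.mul_pos hk hLpos) hn0
    have hvE : M.r * V k ≤ M.En (n k) := by
      rw [div_lt_one hkE] at h3
      exact_mod_cast h3.le
    have hαn : α * (n k:ℝ) = ((k * L * w0 : ℕ):ℝ) := by
      rw [hn]; push_cast; rw [hw0]; ring
    have hfl : ⌊α * (n k:ℝ)⌋₊ = k * L * w0 := by rw [hαn, Nat.floor_natCast]
    obtain ⟨g1, g2⟩ := M.aux_int_lower (hIn k) hnk (N k) (m (V k)) (k * L * w0) (M.r * V k) (hN1 k) (hVr k)
      (by rw [hm1]) hvE h1 h2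
    have hadm : M.Adm α (n k) := by
      rw [aux_Adm_iff, hfl]
      exact ⟨hnk, hIn k, hαn.symm, g1⟩
    have g3 := hG _ hadm
    rw [hfl, ← M.aux_En_eq (hIn k)] at g3
    rw [sub_le_iff_le_add, ← sub_le_iff_le_add']
    refine le_of_mul_le_mul_left ?_ hkE
    have e : (M.En (n k):ℝ) * (((c + 2) + (c + 3) * Real.log ((M.En (n k):ℝ)+1)) / M.En (n k)) = 
       (c + 2) + (c + 3) * Real.log ((M.En (n k):ℝ)+1) := by field_simp
    rw [mul_sub, e]
    linarith
  have := le_of_tendsto (hPhi.sub herr) hfin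
  rwa [sub_zero] at this

end DGLDPC


lemma aux_logsub {l σ x : ℝ} (hl : 0 < l) (hx0 : 0 ≤ x) (hx : x ≤ 1/2) (hσ : σ ≤ l * x) :
    Real.log l - 2 * x ≤ Real.log (l - σ) := by
  have h1 : 0 < 1 - x := by linarith
  have h2 : l * (1 - x) ≤ l - σ := by linarith
  have h3 := Real.log_le_log (mul_pos hl h1) h2
  rw [Real.log_mul hl.ne' h1.ne'] at h3
  have h4 := Real.one_sub_inv_le_log_of_pos h1
  have h5 : (1-x)⁻¹ ≤ 1 + 2 * x := by
    rw [inv_le_iff_one_le_mul₀ h1]; nlinarith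
  linarith

namespace DGLDPC
variable (M : DGLDPC)

lemma aux_log_c {y : ℝ} (hy : 0 < y) {p : Fin M.nv × ℕ × ℕ} (hp : p ∈ M.auxP) :
    Real.log (M.auxc y p) = Real.log (M.lam p.1 / M.q p.1) + Real.log (M.B p.1 p.2.1 p.2.2)
      + (p.2.2:ℝ) / M.r * Real.log M.Cparam + (p.2.1:ℝ) * M.T / M.ψ * (Real.log M.intlam - 1) + p.2.1 * Real.log y := by
  have h1 := M.aux_lq_pos p.1
  have h2 : (0:ℝ) < M.B p.1 p.2.1 p.2.2 := by exact_mod_cast M.aux_P_B hp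
  have hil := M.aux_intlam_pos
  have h3 := Real.rpow_pos_of_pos M.aux_C_pos ((p.2.2 : ℝ) / (M.r : ℝ))
  have h40 : 0 < M.intlam / Real.exp 1 := div_pos hil (Real.exp_pos 1)
  have h4 : 0 < (M.intlam / Real.exp 1) ^ ((p.2.1 : ℝ) * M.T / M.ψ) :=
    Real.rpow_pos_of_pos h40 _
  unfold auxc
  rw [Real.log_mul (by positivity) (by positivity), Real.log_mul (by positivity) (by positivity),
    Real.log_mul (by positivity) (by positivity), Real.log_mul (by positivity) (by positivity),
    Real.log_rpow M.aux_C_pos, Real.log_rpow h40, Real.log_pow, Real.log_div hil.ne' (Real.exp_pos 1).ne', Real.log_exp]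

set_option maxHeartbeats 1000000 in
lemma aux_ideal {y0 : ℝ} (hy0 : 0 < y0) (hQ : M.Q1 y0 = 1) : ∃ K : ℝ, 0 < K ∧ ∃ ε : ℝ, 0 < ε ∧ ∀ α, 0 < α → α ≤ ε →
    ∃ (Y : Fin M.nv × ℕ × ℕ → ℝ) (U : Fin M.nc → ℝ),
    (∀ p ∈ M.auxP, 0 < Y p) ∧ (∀ t ∈ M.auxXc, 0 < U t) ∧
    (∀ t, ∑ p ∈ M.auxP with p.1 = t, Y p < M.lam t / M.q t) ∧
    (∀ t ∈ M.auxXc, U t < M.ρ t / M.s t) ∧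
    (∑ p ∈ M.auxP, (p.2.1:ℝ) * Y p = α * M.intlam) ∧
    (M.r * ∑ t ∈ M.auxXc, U t = ∑ p ∈ M.auxP, (p.2.2:ℝ) * Y p) ∧
    (∑ p ∈ M.auxP, (p.2.2:ℝ) * Y p < 1) ∧
    M.intlam * M.auxMain y0 α - K * α ^ M.ξexp ≤ M.auxPhi Y U := by
  have hil := M.aux_intlam_pos
  have hQ2 := M.aux_Q2_pos hy0
  have hC := M.aux_C_pos
  have hrR := M.aux_r2R
  have hr0 : (0:ℝ) < M.r := by linarith
  have hcp : ∀ p ∈ M.auxP, 0 < M.auxc y0 p := fun p hp => M.aux_c_pos hy0 (M.aux_P_S hp)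
  have hc1 := M.aux_Q1 y0
  have hc2 := M.aux_Q2 y0
  have hc3 := M.aux_sum_c y0
  rw [hQ] at hc1 hc3
  set D := ∑ p ∈ M.auxP, M.auxc y0 p with hD
  have hD0 : 0 < D := Finset.sum_pos hcp M.aux_P_nonempty
  set H : ℝ := D * ∑ t, 1 / (M.lam t / M.q t) + ∑ t, (M.A t M.r : ℝ) / M.Cparam + 1 with hH
  have hs1 : 0 ≤ D * ∑ t, 1 / (M.lam t / M.q t) :=
    mul_nonneg hD0.le (Finset.sum_nonneg fun t _ => (one_div_pos.2 (M.aux_lq_pos t)).le)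
  have hs2 : 0 ≤ ∑ t, (M.A t M.r : ℝ) / M.Cparam := Finset.sum_nonneg fun t _ => by positivity
  have hH1 : 1 ≤ H := by linarith
  have hHl : ∀ t, D ≤ M.lam t / M.q t * H := by
    intro t
    have h1 := M.aux_lq_pos t
    have h2 : 1 / (M.lam t / M.q t) ≤ ∑ t, 1 / (M.lam t / M.q t) :=
      Finset.single_le_sum (f := fun t => 1 / (M.lam t / M.q t)) (fun t _ => (one_div_pos.2 (M.aux_lq_pos t)).le) (Finset.mem_univ t)
    have h3 : D * (1 / (M.lam t / M.q t)) ≤ H := by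
      have := mul_le_mul_of_nonneg_left h2 hD0.le
      linarith
    calc D = M.lam t / M.q t * (D * (1 / (M.lam t / M.q t))) := by
          rw [← mul_assoc, mul_comm _ D, mul_assoc, mul_one_div_cancel h1.ne', mul_one]
      _ ≤ _ := mul_le_mul_of_nonneg_left h3 h1.le
  have hHA : ∀ t, (M.A t M.r : ℝ) / M.Cparam ≤ H := by
    intro t
    have h2 : (M.A t M.r : ℝ) / M.Cparam ≤ ∑ t, (M.A t M.r : ℝ) / M.Cparam :=
      Finset.single_le_sum (f := fun t => (M.A t M.r : ℝ) / M.Cparam) (fun t _ => by positivity) (Finset.mem_univ t)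
    linarith
  set κ := M.intlam / M.Q2 y0 with hκ
  have hκ0 : 0 < κ := div_pos hil hQ2
  refine ⟨2 * H * (D+1) * κ^2, by positivity, min 1 (1 / (2 * H * κ)), lt_min one_pos (by positivity), ?_⟩
  intro α hα hαε
  have hα1 : α ≤ 1 := hαε.trans (min_le_left _ _)
  have hα2 : α ≤ 1 / (2 * H * κ) := hαε.trans (min_le_right _ _)
  set b := κ * α with hb
  have hb0 : 0 < b := mul_pos hκ0 hα
  have hbH : b * H ≤ 1/2 := by
    rw [le_div_iff₀ (by positivity)] at hα2
    rw [hb]; nlinarith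
  have hbH0 : 0 ≤ b * H := by positivity
  have hbl : b < 1 := by nlinarith
  have hbQ : b * M.Q2 y0 = α * M.intlam := by
    rw [hb, hκ]; field_simp
  have e1 : ∑ p ∈ M.auxP, (p.2.1:ℝ) * (b * M.auxc y0 p) = α * M.intlam := by
    rw [← hbQ, hc2, Finset.mul_sum]; exact Finset.sum_congr rfl fun p _ => by ring
  have e2 : ∑ p ∈ M.auxP, (p.2.2:ℝ) * (b * M.auxc y0 p) = b := by
    calc _ = b * ∑ p ∈ M.auxP, (p.2.2:ℝ) * M.auxc y0 p := by
          rw [Finset.mul_sum]; exact Finset.sum_congr rfl fun p _ => by ring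
      _ = b := by rw [← hc1, mul_one]
  have e3 : ∑ t ∈ M.auxXc, M.ρ t / M.s t * M.A t M.r * b / M.Cparam = b / M.r := by
    have hCd : M.Cparam = M.r * ∑ t ∈ M.auxXc, M.ρ t * M.A t M.r / M.s t := rfl
    have h1 : ∑ t ∈ M.auxXc, M.ρ t / M.s t * M.A t M.r * b / M.Cparam
        = b / M.Cparam * ∑ t ∈ M.auxXc, M.ρ t * M.A t M.r / M.s t := by
      rw [Finset.mul_sum]; exact Finset.sum_congr rfl fun p _ => by ring
    have h2 : ∑ t ∈ M.auxXc, M.ρ t * M.A t M.r / M.s t = M.Cparam / M.r := by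
      rw [hCd]; field_simp
    rw [h1, h2]; field_simp
  have hApos : ∀ t ∈ M.auxXc, (0:ℝ) < M.A t M.r := fun t ht => by exact_mod_cast M.aux_Xc_A ht
  have hUpos : ∀ t ∈ M.auxXc, 0 < M.ρ t / M.s t * M.A t M.r * b / M.Cparam := fun t ht => by
    have := M.aux_rs_pos t
    have := hApos t ht
    positivity
  have hσ : ∀ t, ∑ p ∈ M.auxP with p.1 = t, b * M.auxc y0 p ≤ M.lam t / M.q t * (b * H) := by
    intro t
    calc _ ≤ ∑ p ∈ M.auxP, b * M.auxc y0 p :=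
          Finset.sum_le_sum_of_subset_of_nonneg (Finset.filter_subset _ _) fun p hp _ => (mul_pos hb0 (hcp p hp)).le
      _ = b * D := by rw [hD, Finset.mul_sum]
      _ ≤ b * (M.lam t / M.q t * H) := mul_le_mul_of_nonneg_left (hHl t) hb0.le
      _ = _ := by ring
  have hμ : ∀ t, M.ρ t / M.s t * M.A t M.r * b / M.Cparam ≤ M.ρ t / M.s t * (b * H) := by
    intro t
    calc _ = M.ρ t / M.s t * (b * ((M.A t M.r : ℝ) / M.Cparam)) := by ring
      _ ≤ _ := mul_le_mul_of_nonneg_left (mul_le_mul_of_nonneg_left (hHA t) hb0.le) (M.aux_rs_pos t).le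
  refine ⟨fun p => b * M.auxc y0 p, fun t => M.ρ t / M.s t * M.A t M.r * b / M.Cparam,
    fun p hp => mul_pos hb0 (hcp p hp), hUpos, ?_, ?_, e1, ?_, ?_, ?_⟩
  · intro t
    have := M.aux_lq_pos t
    refine (hσ t).trans_lt ?_
    nlinarith
  · intro t _
    have := M.aux_rs_pos t
    refine (hμ t).trans_lt ?_
    nlinarith
  · rw [e2, e3]; field_simp
  · rw [e2]; exact hbl
  unfold auxPhi
  dsimp only
  rw [e2]
  have hYl : b * ((1 - Real.log b - 2 * (b * H)) * D - Real.log M.Cparam / M.r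
      - (M.T / M.ψ * (Real.log M.intlam - 1) + Real.log y0) * M.Q2 y0) ≤
      ∑ p ∈ M.auxP, b * M.auxc y0 p * (Real.log (M.lam p.1 / M.q p.1 - ∑ p' ∈ M.auxP with p'.1 = p.1, b * M.auxc y0 p')
        - Real.log (b * M.auxc y0 p) + 1 + Real.log (M.B p.1 p.2.1 p.2.2)) := by
    have : b * ((1 - Real.log b - 2 * (b * H)) * D - Real.log M.Cparam / M.r
      - (M.T / M.ψ * (Real.log M.intlam - 1) + Real.log y0) * M.Q2 y0) =
      ∑ p ∈ M.auxP, (b * (1 - Real.log b - 2 * (b * H)) * M.auxc y0 p - b * (Real.log M.Cparam / M.r) * ((p.2.2:ℝ) * M.auxc y0 p)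
        - b * (M.T / M.ψ * (Real.log M.intlam - 1) + Real.log y0) * ((p.2.1:ℝ) * M.auxc y0 p)) := by
      rw [Finset.sum_sub_distrib, Finset.sum_sub_distrib, ← Finset.mul_sum, ← Finset.mul_sum, ← Finset.mul_sum,
        ← hc1, ← hc2, ← hD]; ring
    rw [this]
    refine Finset.sum_le_sum fun p hp => ?_
    have h1 := aux_logsub (M.aux_lq_pos p.1) hbH0 hbH (hσ p.1)
    rw [Real.log_mul hb0.ne' (hcp p hp).ne', M.aux_log_c hy0 hp]
    have h2 := mul_le_mul_of_nonneg_left h1 (mul_pos hb0 (hcp p hp)).le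
    refine le_of_eq_of_le ?_ (le_trans (add_le_add_left h2 (b * M.auxc y0 p * (- (Real.log b + (Real.log (M.lam p.1 / M.q p.1) + Real.log (M.B p.1 p.2.1 p.2.2)
      + (p.2.2:ℝ) / M.r * Real.log M.Cparam + (p.2.1:ℝ) * M.T / M.ψ * (Real.log M.intlam - 1) + p.2.1 * Real.log y0)) + 1 + Real.log (M.B p.1 p.2.1 p.2.2)))) (le_of_eq ?_))
    · ring
    · ring
  have hUl : b / M.r * (Real.log M.Cparam - Real.log b + 1 - 2 * (b * H)) ≤
      ∑ t ∈ M.auxXc, M.ρ t / M.s t * M.A t M.r * b / M.Cparam * (Real.log (M.ρ t / M.s t - M.ρ t / M.s t * M.A t M.r * b / M.Cparam)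
        - Real.log (M.ρ t / M.s t * M.A t M.r * b / M.Cparam) + 1 + Real.log (M.A t M.r)) := by
    rw [← e3, Finset.sum_mul]
    refine Finset.sum_le_sum fun t ht => mul_le_mul_of_nonneg_left ?_ (hUpos t ht).le
    have h1 := aux_logsub (M.aux_rs_pos t) hbH0 hbH (hμ t)
    have h2 := M.aux_rs_pos t
    have h3 := hApos t ht
    have h4 : Real.log (M.ρ t / M.s t * M.A t M.r * b / M.Cparam) = Real.log (M.ρ t / M.s t) + Real.log (M.A t M.r) + Real.log b - Real.log M.Cparam := by
      rw [Real.log_div (by positivity) hC.ne', Real.log_mul (by positivity) hb0.ne', Real.log_mul h2.ne' h3.ne']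
    linarith
  have hlb : Real.log b = Real.log M.intlam - Real.log (M.Q2 y0) + Real.log α := by
    rw [hb, hκ, Real.log_mul (by positivity) hα.ne', Real.log_div hil.ne' hQ2.ne']
  have hpw : α ^ (2:ℝ) ≤ α ^ M.ξexp := Real.rpow_le_rpow_of_exponent_ge hα hα1 M.aux_xi_le2
  rw [Real.rpow_two] at hpw
  have hmain : M.intlam * M.auxMain y0 α = b * ((1 - Real.log b - 2 * (b * H)) * D - Real.log M.Cparam / M.r
      - (M.T / M.ψ * (Real.log M.intlam - 1) + Real.log y0) * M.Q2 y0) + b / M.r * (Real.log M.Cparam - Real.log b + 1 - 2 * (b * H))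
      + (b * Real.log b - b) + 2 * H * (D + 1 / M.r) * b^2 := by
    have hDe : D = (1 - 1 / (M.r:ℝ)) - (M.T / M.ψ) * M.Q2 y0 := by
      rw [← M.aux_psi_inv, hc3]; ring
    unfold auxMain
    rw [Real.log_div one_ne_zero hy0.ne', Real.log_div one_ne_zero hQ2.ne', Real.log_one, hDe]
    have : M.intlam * (M.T / M.ψ * α * Real.log α + α * (0 - Real.log y0 + M.T / M.ψ * (0 - Real.log (M.Q2 y0))))
      = b * M.Q2 y0 * (M.T / M.ψ * (Real.log α - Real.log (M.Q2 y0)) - Real.log y0) := by rw [hbQ]; ring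
    rw [this]
    have : Real.log α - Real.log (M.Q2 y0) = Real.log b - Real.log M.intlam := by rw [hlb]; ring
    rw [this]
    ring
  have hr1 : 1 / (M.r:ℝ) ≤ 1 := by rw [div_le_one hr0]; linarith
  have herr : 2 * H * (D + 1 / M.r) * b^2 ≤ 2 * H * (D+1) * κ^2 * α ^ M.ξexp := by
    calc _ ≤ 2 * H * (D + 1) * b^2 := by gcongr
      _ = 2 * H * (D + 1) * κ^2 * α^2 := by rw [hb]; ring
      _ ≤ _ := by gcongr
  linarith

end DGLDPC


namespace DGLDPC
variable (M : DGLDPC)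

lemma aux_final : 
    ∃ y : ℝ, (0 ≤ y ∧ M.Q1 y = 1 ∧ ∀ y' : ℝ, 0 ≤ y' → M.Q1 y' = 1 → y' = y) ∧
      ∃ k : ℝ, 0 < k ∧ ∃ ε : ℝ, 0 < ε ∧
        ∀ α : ℝ, 0 < α → α ≤ ε → {n : ℕ | M.Adm α n}.Infinite →
          ∃ G : ℝ,
            Filter.Tendsto (M.grSeq α)
              (Filter.atTop ⊓ Filter.principal {n : ℕ | M.Adm α n}) (nhds G) ∧
            |G - M.auxMain y α| ≤ k * α ^ M.ξexp := by
  obtain ⟨y, hy, hQ, huniq⟩ := M.aux_y_exists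
  refine ⟨y, ⟨hy.le, hQ, huniq⟩, ?_⟩
  obtain ⟨K1, hK1, hup⟩ := M.aux_upper hy hQ
  obtain ⟨K2, hK2, ε2, hε2, hlow⟩ := M.aux_ideal hy hQ
  have hil := M.aux_intlam_pos
  have hD0 : (0:ℝ) ≤ M.auxD := Nat.cast_nonneg _
  have hDi : 0 ≤ M.auxD * M.intlam := mul_nonneg hD0 hil.le
  refine ⟨max K1 (K2 / M.intlam), lt_max_of_lt_left hK1, min (min 1 ε2) (1 / (M.auxD * M.intlam + 1)),
    lt_min (lt_min one_pos hε2) (by positivity), ?_⟩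
  intro α hα hαε hinf
  have hα1 : α ≤ 1 := hαε.trans ((min_le_left _ _).trans (min_le_left _ _))
  have hα2 : α ≤ ε2 := hαε.trans ((min_le_left _ _).trans (min_le_right _ _))
  have hα3 : α ≤ 1 / (M.auxD * M.intlam + 1) := hαε.trans (min_le_right _ _)
  have hsm : M.auxD * α * M.intlam < 1 := by
    rw [le_div_iff₀ (by positivity)] at hα3
    nlinarith
  have hpos : 0 < α ^ M.ξexp := Real.rpow_pos_of_pos hα _
  set c : ℕ → ℝ := fun n => Real.log (M.ENw n ⌊α * (n : ℝ)⌋₊) - (2 + 3 * Real.log ((M.En n:ℝ)+1)) with hc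
  set S : Set ℝ := {x | ∃ n, M.Adm α n ∧ x = c n / n} with hS
  obtain ⟨n1, hn1⟩ := hinf.nonempty
  have hSne : S.Nonempty := ⟨_, n1, hn1, rfl⟩
  have hSub : ∀ x ∈ S, x ≤ M.auxMain y α + K1 * α ^ M.ξexp := by
    rintro x ⟨n, hn, rfl⟩
    have h0 : (0:ℝ) < n := by exact_mod_cast hn.1
    rw [div_le_iff₀ h0]
    have := hup α hα hα1 n hn
    simp only [hc]; linarith
  have hbdd : BddAbove S := ⟨_, hSub⟩
  set G := sSup S with hG
  have hcG : ∀ n, M.Adm α n → c n ≤ G * n := by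
    intro n hn
    have h0 : (0:ℝ) < n := by exact_mod_cast hn.1
    rw [← div_le_iff₀ h0]
    exact le_csSup hbdd ⟨n, hn, rfl⟩
  refine ⟨G, ?_, ?_⟩
  · have hlog : Tendsto (fun x : ℝ => Real.log (x+1) / x) atTop (nhds 0) := by
      have h1 : Tendsto (fun x : ℝ => Real.log (x+1) / (1 * (x + 1) + (-1))) atTop (nhds 0) := by
        have := Real.tendsto_pow_log_div_mul_add_atTop 1 (-1) 1 one_ne_zero
        have h2 := this.comp (tendsto_atTop_add_const_right atTop (1:ℝ) tendsto_id)
        refine h2.congr fun x => ?_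
        simp
      refine h1.congr fun x => ?_
      congr 1; ring
    have hnt : Tendsto (fun n : ℕ => (n:ℝ)) atTop atTop := tendsto_natCast_atTop_atTop
    have hEt : Tendsto (fun n : ℕ => (n:ℝ) / M.intlam) atTop atTop := hnt.atTop_div_const hil
    have herr : Tendsto (fun n : ℕ => (2 + 3 * Real.log ((n:ℝ)/M.intlam+1)) / n) atTop (nhds 0) := by
      have h1 := (hnt.const_div_atTop 2).add ((hlog.comp hEt).const_mul (3 / M.intlam))
      rw [mul_zero, add_zero] at h1
      refine h1.congr fun n => ?_
      simp only [Function.comp]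
      field_simp
    refine tendsto_order.2 ⟨fun a ha => ?_, fun a ha => ?_⟩
    · obtain ⟨x, ⟨n0, hn0, rfl⟩, hx⟩ := exists_lt_of_lt_csSup hSne ha
      obtain ⟨K, hK⟩ := M.aux_fekete α hα hsm n0 hn0
      rw [Filter.eventually_inf_principal]
      have h1 : Tendsto (fun n : ℕ => c n0 / n0 - K / n) atTop (nhds (c n0 / n0 - 0)) :=
        (hnt.const_div_atTop K).const_sub _
      rw [sub_zero] at h1
      filter_upwards [h1.eventually_const_lt hx] with n h2 hn
      have h0 : (0:ℝ) < n := by exact_mod_cast hn.1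
      refine h2.trans_le ?_
      have h3 := hK n hn
      unfold grSeq
      rw [one_div, inv_mul_eq_div, le_div_iff₀ h0]
      have e : (c n0 / n0 - K / n) * n = n * (c n0 / n0) - K := by field_simp
      rw [e]; exact h3
    · rw [Filter.eventually_inf_principal]
      have h1 := herr.const_add G
      rw [add_zero] at h1
      filter_upwards [h1.eventually_lt_const ha] with n h2 hn
      have h0 : (0:ℝ) < n := by exact_mod_cast hn.1
      refine lt_of_le_of_lt ?_ h2
      have h3 := hcG n hn
      simp only [hc] at h3
      rw [hn.2.1] at h3
      unfold grSeq
      rw [one_div, inv_mul_eq_div, div_le_iff₀ h0, add_mul, div_mul_cancel₀ _ h0.ne']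
      linarith
  · obtain ⟨Y, U, hY, hU, hσ, hμ, hYi, hUY, hβ, hP⟩ := hlow α hα hα2
    have h1 := M.aux_lower_lim hα hn1 hY hU hσ hμ hYi hUY hβ hcG
    have h2 : G ≤ M.auxMain y α + K1 * α ^ M.ξexp := csSup_le hSne hSub
    have h3 : M.auxMain y α - K2 / M.intlam * α ^ M.ξexp ≤ G := by
      have h4 := hP.trans h1
      have e : M.intlam * (M.auxMain y α - K2 / M.intlam * α ^ M.ξexp) = M.intlam * M.auxMain y α - K2 * α ^ M.ξexp := by
        field_simp
      refine le_of_mul_le_mul_left ?_ hil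
      rw [e]; linarith
    have h5 := mul_le_mul_of_nonneg_right (le_max_left K1 (K2 / M.intlam)) hpos.le
    have h6 := mul_le_mul_of_nonneg_right (le_max_right K1 (K2 / M.intlam)) hpos.le
    rw [abs_le]; constructor <;> linarith

end DGLDPC



/-- **Theorem 1** (growth rate of the weight distribution of irregular D-GLDPC ensembles).
For an irregular D-GLDPC code ensemble sequence, the limit defining the growth rate `G(α)`
exists for all sufficiently small admissible `α > 0`, and
`G(α) = (T/ψ) α log α + α [ log(1/Q₁⁻¹(1)) + (T/ψ) log(1/Q₂(Q₁⁻¹(1))) ] + O(α^ξ)`,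
where `ξ = min { r̄/r, χ/ψ + 1, 2 }`.  Here `y = Q₁⁻¹(1)` is encoded as the unique
nonnegative solution of `Q₁ y = 1`. -/
theorem growth_rate_weight_distribution_DGLDPC (M : DGLDPC) :
    ∃ y : ℝ, (0 ≤ y ∧ M.Q1 y = 1 ∧ ∀ y' : ℝ, 0 ≤ y' → M.Q1 y' = 1 → y' = y) ∧
      ∃ k : ℝ, 0 < k ∧ ∃ ε : ℝ, 0 < ε ∧
        ∀ α : ℝ, 0 < α → α ≤ ε → {n : ℕ | M.Adm α n}.Infinite →
          ∃ G : ℝ,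
            Filter.Tendsto (M.grSeq α)
              (Filter.atTop ⊓ Filter.principal {n : ℕ | M.Adm α n}) (nhds G) ∧
            |G - ((M.T / M.ψ) * α * Real.log α +
                α * (Real.log (1 / y) + (M.T / M.ψ) * Real.log (1 / M.Q2 y)))| ≤
              k * α ^ M.ξexp := by
  exact M.aux_final
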